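/- arXiv:0807.5107 — 2 statements merged into one kernel-verified Lean document; each statement's English description precedes it below -/
import Mathlib

section
/- (Theorem 3.1, stability) Under the standing hypotheses, if either C'(t) ≤ 0 for all t ≥ 0, or C'(t) → 0 as t → ∞, then the null solution is stable: there exist ξ > 0 (with ξ ≤ ρ when ρ < ∞) and κ ≥ 0 such that for every σ ∈ (0, ξ] and every t₀ ≥ κ there is δ = δ(σ, t₀) > 0 such that every classical solution u on [t₀,∞) with d(t₀) < δ satisfies d(t) < σ for all t ≥ t₀. -/
open Real Set MeasureTheory Filter

/-- A classical solution on `[t₀, ∞)` of the initial-boundary-value problem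
`-ε(t) u_xxt + u_tt - C(t) u_xx + a' u_t = F(u) - a u_t` on `(0,π) × (t₀,∞)`,
with Dirichlet boundary conditions `u(0,t) = u(π,t) = 0`.  The partial
derivatives are recorded as data, together with the hypotheses that they really
are the derivatives and that all of them are continuous on the closed
space-time domain. -/
structure ClassicalSolution (ε C F : ℝ → ℝ) (a' t₀ : ℝ) where
  u : ℝ → ℝ → ℝ
  ux : ℝ → ℝ → ℝ
  uxx : ℝ → ℝ → ℝ
  ut : ℝ → ℝ → ℝ
  utt : ℝ → ℝ → ℝ
  uxxt : ℝ → ℝ → ℝ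
  aa : ℝ → ℝ → ℝ
  hux : ∀ t ∈ Ici t₀, ∀ x ∈ Icc (0:ℝ) π,
    HasDerivWithinAt (fun y => u y t) (ux x t) (Icc 0 π) x
  huxx : ∀ t ∈ Ici t₀, ∀ x ∈ Icc (0:ℝ) π,
    HasDerivWithinAt (fun y => ux y t) (uxx x t) (Icc 0 π) x
  hut : ∀ x ∈ Icc (0:ℝ) π, ∀ t ∈ Ici t₀,
    HasDerivWithinAt (fun s => u x s) (ut x t) (Ici t₀) t
  hutt : ∀ x ∈ Icc (0:ℝ) π, ∀ t ∈ Ici t₀,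
    HasDerivWithinAt (fun s => ut x s) (utt x t) (Ici t₀) t
  huxxt : ∀ x ∈ Icc (0:ℝ) π, ∀ t ∈ Ici t₀,
    HasDerivWithinAt (fun s => uxx x s) (uxxt x t) (Ici t₀) t
  cont_u : ContinuousOn (Function.uncurry u) (Icc 0 π ×ˢ Ici t₀)
  cont_ux : ContinuousOn (Function.uncurry ux) (Icc 0 π ×ˢ Ici t₀)
  cont_uxx : ContinuousOn (Function.uncurry uxx) (Icc 0 π ×ˢ Ici t₀)
  cont_ut : ContinuousOn (Function.uncurry ut) (Icc 0 π ×ˢ Ici t₀)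
  cont_utt : ContinuousOn (Function.uncurry utt) (Icc 0 π ×ˢ Ici t₀)
  cont_uxxt : ContinuousOn (Function.uncurry uxxt) (Icc 0 π ×ˢ Ici t₀)
  cont_aa : ContinuousOn (Function.uncurry aa) (Icc 0 π ×ˢ Ici t₀)
  aa_nonneg : ∀ x ∈ Icc (0:ℝ) π, ∀ t ∈ Ici t₀, 0 ≤ aa x t
  pde : ∀ x ∈ Ioo (0:ℝ) π, ∀ t ∈ Ioi t₀,
    -(ε t) * uxxt x t + utt x t - C t * uxx x t + a' * ut x t
      = F (u x t) - aa x t * ut x t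
  bc0 : ∀ t ∈ Ici t₀, u 0 t = 0
  bcπ : ∀ t ∈ Ici t₀, u π t = 0

/-- The time-dependent norm `d(t)` of a solution:
`d(t)² = ∫₀^π [ε(t)² u_xx² + u_x² + u² + u_t²] dx`. -/
noncomputable def ClassicalSolution.d {ε C F : ℝ → ℝ} {a' t₀ : ℝ}
    (S : ClassicalSolution ε C F a' t₀) (t : ℝ) : ℝ :=
  Real.sqrt (∫ x in (0:ℝ)..π,
    ((ε t)^2 * (S.uxx x t)^2 + (S.ux x t)^2 + (S.u x t)^2 + (S.ut x t)^2))

namespace StabAux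


lemma ii {f : ℝ → ℝ} (h : ContinuousOn f (Icc 0 π)) : IntervalIntegrable f volume 0 π := by
  apply ContinuousOn.intervalIntegrable
  rwa [uIcc_of_le pi_pos.le]

lemma ibp {p q p' q' : ℝ → ℝ}
    (hp : ∀ x ∈ Icc (0:ℝ) π, HasDerivWithinAt p (p' x) (Icc 0 π) x)
    (hq : ∀ x ∈ Icc (0:ℝ) π, HasDerivWithinAt q (q' x) (Icc 0 π) x)
    (hp' : ContinuousOn p' (Icc 0 π)) (hq' : ContinuousOn q' (Icc 0 π))
    (h0 : p 0 = 0) (h1 : p π = 0) :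
    ∫ x in (0:ℝ)..π, p x * q' x = - ∫ x in (0:ℝ)..π, p' x * q x := by
  rw [intervalIntegral.integral_mul_deriv_eq_deriv_mul_of_hasDerivAt (u := p) (v := q) (u' := p')
    (v' := q')]
  · rw [h0, h1]; ring
  · rw [uIcc_of_le pi_pos.le]; exact fun x hx => (hp x hx).continuousWithinAt
  · rw [uIcc_of_le pi_pos.le]; exact fun x hx => (hq x hx).continuousWithinAt
  · rw [min_eq_left pi_pos.le, max_eq_right pi_pos.le]
    exact fun x hx => (hp x ⟨hx.1.le, hx.2.le⟩).hasDerivAt (Icc_mem_nhds hx.1 hx.2)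
  · rw [min_eq_left pi_pos.le, max_eq_right pi_pos.le]
    exact fun x hx => (hq x ⟨hx.1.le, hx.2.le⟩).hasDerivAt (Icc_mem_nhds hx.1 hx.2)
  · exact ii hp'
  · exact ii hq'

lemma poincare_lam {f f' : ℝ → ℝ}
    (hf : ∀ x ∈ Icc (0:ℝ) π, HasDerivWithinAt f (f' x) (Icc 0 π) x)
    (hf' : ContinuousOn f' (Icc 0 π)) (h0 : f 0 = 0) (h1 : f π = 0) (l : ℝ) (hl0 : 0 < l)
    (hl : l < 1) :
    l ^ 2 * ∫ x in (0:ℝ)..π, f x ^ 2 ≤ ∫ x in (0:ℝ)..π, f' x ^ 2 := by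
  have hfc : ContinuousOn f (Icc 0 π) := fun x hx => (hf x hx).continuousWithinAt
  have hcos : ∀ x ∈ Icc (0:ℝ) π, 0 < cos (l * (x - π / 2)) := by
    intro x hx
    apply cos_pos_of_mem_Ioo
    have := pi_pos
    constructor <;> nlinarith [hx.1, hx.2]
  have htan : ContinuousOn (fun x => tan (l * (x - π / 2))) (Icc 0 π) := by
    have : (fun x => tan (l * (x - π / 2))) =
      fun x => sin (l * (x - π / 2)) / cos (l * (x - π / 2)) := by
      ext x; rw [tan_eq_sin_div_cos]
    rw [this]
    exact ContinuousOn.div (by fun_prop) (by fun_prop) (fun x hx => (hcos x hx).ne')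
  have key : ∫ x in (0:ℝ)..π, (2 * f x * f' x * (l * tan (l * (x - π / 2)))
      + f x ^ 2 * (l ^ 2 * (1 + tan (l * (x - π / 2)) ^ 2))) = 0 := by
    rw [intervalIntegral.integral_eq_sub_of_hasDerivAt_of_le
      (f := fun x => f x ^ 2 * (l * tan (l * (x - π / 2)))) pi_pos.le]
    · simp [h0, h1]
    · fun_prop
    · intro x hx
      have hc := (hcos x ⟨hx.1.le, hx.2.le⟩)
      have h1 := (hf x ⟨hx.1.le, hx.2.le⟩).hasDerivAt (Icc_mem_nhds hx.1 hx.2)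
      have h2 : HasDerivAt (fun x : ℝ => l * (x - π / 2)) (l * 1) x :=
        ((hasDerivAt_id x).sub_const _).const_mul l
      have h3 := (HasDerivAt.comp x (hasDerivAt_tan hc.ne') h2).const_mul l
      have h4 := (h1.pow 2).mul h3
      refine h4.congr_deriv ?_
      simp only [Function.comp]
      rw [tan_eq_sin_div_cos]
      have := sin_sq_add_cos_sq (l * (x - π / 2))
      have e : 1 + (sin (l * (x - π / 2)) / cos (l * (x - π / 2))) ^ 2
        = 1 / cos (l * (x - π / 2)) ^ 2 := by
        rw [div_pow, ← this, add_div, div_self (pow_ne_zero 2 hc.ne'), add_comm]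
        rw [this]
      rw [e]; simp only [Pi.pow_apply]; push_cast; ring
    · apply ii; fun_prop
  have : ∫ x in (0:ℝ)..π, l ^ 2 * f x ^ 2 ≤ ∫ x in (0:ℝ)..π, (f' x ^ 2 +
      (2 * f x * f' x * (l * tan (l * (x - π / 2)))
      + f x ^ 2 * (l ^ 2 * (1 + tan (l * (x - π / 2)) ^ 2)))) := by
    apply intervalIntegral.integral_mono_on pi_pos.le
    · apply ii; fun_prop
    · apply ii; fun_prop
    · intro x hx
      nlinarith [sq_nonneg (f' x + f x * (l * tan (l * (x - π / 2))))]
  rw [intervalIntegral.integral_add, key, intervalIntegral.integral_const_mul] at this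
  · linarith
  · apply ii; fun_prop
  · apply ii; fun_prop

lemma poincare {f f' : ℝ → ℝ}
    (hf : ∀ x ∈ Icc (0:ℝ) π, HasDerivWithinAt f (f' x) (Icc 0 π) x)
    (hf' : ContinuousOn f' (Icc 0 π)) (h0 : f 0 = 0) (h1 : f π = 0) :
    ∫ x in (0:ℝ)..π, f x ^ 2 ≤ ∫ x in (0:ℝ)..π, f' x ^ 2 := by
  have h : Tendsto (fun l : ℝ => l ^ 2 * ∫ x in (0:ℝ)..π, f x ^ 2) (nhdsWithin 1 (Iio 1))
      (nhds (1 ^ 2 * ∫ x in (0:ℝ)..π, f x ^ 2)) := by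
    apply Tendsto.mono_left _ nhdsWithin_le_nhds
    exact Continuous.tendsto (by fun_prop) 1
  rw [one_pow, one_mul] at h
  refine le_of_tendsto h ?_
  have : Ioo (0:ℝ) 1 ∈ nhdsWithin (1:ℝ) (Iio 1) := Ioo_mem_nhdsLT one_pos
  filter_upwards [this] with l hl
  exact poincare_lam hf hf' h0 h1 l hl.1 hl.2

lemma sup_bound {f f' : ℝ → ℝ}
    (hf : ∀ x ∈ Icc (0:ℝ) π, HasDerivWithinAt f (f' x) (Icc 0 π) x)
    (hf' : ContinuousOn f' (Icc 0 π)) (h0 : f 0 = 0) {x : ℝ} (hx : x ∈ Icc 0 π) :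
    f x ^ 2 ≤ π * ∫ y in (0:ℝ)..π, f' y ^ 2 := by
  have hsub : Icc 0 x ⊆ Icc 0 π := Icc_subset_Icc_right hx.2
  have hc := hf'.mono hsub
  have I {g : ℝ → ℝ} (h : ContinuousOn g (Icc 0 x)) : IntervalIntegrable g volume 0 x := by
    apply ContinuousOn.intervalIntegrable
    rwa [uIcc_of_le hx.1]
  have e1 : ∫ y in (0:ℝ)..x, f' y = f x := by
    rw [intervalIntegral.integral_eq_sub_of_hasDerivAt_of_le (f := f) hx.1]
    · rw [h0]; ring
    · exact fun y hy => ((hf y (hsub hy)).continuousWithinAt).mono hsub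
    · exact fun y hy => (hf y (hsub ⟨hy.1.le, hy.2.le⟩)).hasDerivAt
        (Icc_mem_nhds hy.1 (hy.2.trans_le hx.2))
    · exact I hc
  have e2 : ∫ y in (0:ℝ)..x, f' y ^ 2 ≤ ∫ y in (0:ℝ)..π, f' y ^ 2 := by
    apply intervalIntegral.integral_mono_interval le_rfl hx.1 hx.2
    · exact Eventually.of_forall fun y => sq_nonneg _
    · exact ii (by fun_prop)
  have e3 : ∫ y in (0:ℝ)..x, (2 * (f x / π) * f' y - (f x / π) ^ 2) ≤
      ∫ y in (0:ℝ)..x, f' y ^ 2 := by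
    apply intervalIntegral.integral_mono_on hx.1
    · exact I (by fun_prop)
    · exact I (by fun_prop)
    · intro y hy
      nlinarith [sq_nonneg (f' y - f x / π)]
  rw [intervalIntegral.integral_sub (I (by fun_prop)) (I (by fun_prop)),
    intervalIntegral.integral_const_mul, e1] at e3
  simp only [intervalIntegral.integral_const, sub_zero, smul_eq_mul] at e3
  have e4 : x * (f x / π) ^ 2 ≤ π * (f x / π) ^ 2 :=
    mul_le_mul_of_nonneg_right hx.2 (sq_nonneg _)
  have hp := pi_pos
  have e5 : f x = π * (f x / π) := by field_simp
  set m := f x / π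
  rw [e5] at e3 ⊢
  have : π * m ^ 2 ≤ ∫ y in (0:ℝ)..π, f' y ^ 2 := by nlinarith
  nlinarith

/-- Continuity of parametric integrals. -/
lemma cont_param {g : ℝ → ℝ → ℝ} {t₀ : ℝ}
    (hg : ContinuousOn (Function.uncurry g) (Icc 0 π ×ˢ Ici t₀)) :
    ContinuousOn (fun t => ∫ x in (0:ℝ)..π, g x t) (Ici t₀) := by
  have hc : Continuous (Function.uncurry fun t x => g (max 0 (min x π)) (max t₀ t)) := by
    have : (Function.uncurry fun t x => g (max 0 (min x π)) (max t₀ t)) =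
      (Function.uncurry g) ∘ fun p : ℝ × ℝ => (max 0 (min p.2 π), max t₀ p.1) := by
      ext p; rfl
    rw [this]
    apply hg.comp_continuous (by fun_prop)
    intro p
    refine ⟨⟨le_max_left _ _, max_le pi_pos.le (min_le_right _ _)⟩, ?_⟩
    exact le_max_left t₀ p.1
  have h := intervalIntegral.continuous_parametric_intervalIntegral_of_continuous'
    (μ := volume) hc 0 π
  refine h.continuousOn.congr ?_
  intro t ht
  apply intervalIntegral.integral_congr
  intro x hx
  rw [uIcc_of_le pi_pos.le] at hx
  simp only
  rw [min_eq_left hx.2, max_eq_right hx.1, max_eq_right ht]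

lemma slice {g : ℝ → ℝ → ℝ} {t₀ : ℝ}
    (hg : ContinuousOn (Function.uncurry g) (Icc 0 π ×ˢ Ici t₀)) {t : ℝ} (ht : t₀ ≤ t) :
    ContinuousOn (fun x => g x t) (Icc 0 π) := by
  have : (fun x => g x t) = Function.uncurry g ∘ fun x => (x, t) := rfl
  rw [this]
  exact hg.comp (by fun_prop) (fun x hx => ⟨hx, ht⟩)

lemma bdd {g : ℝ → ℝ → ℝ} {t₀ : ℝ}
    (hg : ContinuousOn (Function.uncurry g) (Icc 0 π ×ˢ Ici t₀)) (b : ℝ) :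
    ∃ M, ∀ x ∈ Icc (0:ℝ) π, ∀ s ∈ Icc t₀ b, |g x s| ≤ M := by
  obtain ⟨M, hM⟩ := (isCompact_Icc.prod (isCompact_Icc (a := t₀) (b := b))).exists_bound_of_continuousOn
    (hg.mono (prod_mono_right Icc_subset_Ici_self))
  exact ⟨M, fun x hx s hs => hM (x, s) ⟨hx, hs⟩⟩

lemma deriv_param {g g' : ℝ → ℝ → ℝ} {t₀ : ℝ}
    (hg : ContinuousOn (Function.uncurry g) (Icc 0 π ×ˢ Ici t₀))
    (hg' : ContinuousOn (Function.uncurry g') (Icc 0 π ×ˢ Ici t₀))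
    (hd : ∀ x ∈ Icc (0:ℝ) π, ∀ t, t₀ < t → HasDerivAt (fun s => g x s) (g' x t) t)
    {t : ℝ} (ht : t₀ < t) :
    HasDerivAt (fun t => ∫ x in (0:ℝ)..π, g x t) (∫ x in (0:ℝ)..π, g' x t) t := by
  obtain ⟨M, hM⟩ := bdd hg' (t + 1)
  have hI : ∀ x, x ∈ uIoc 0 π → x ∈ Icc 0 π := by
    intro x hx
    rw [uIoc_of_le pi_pos.le] at hx
    exact ⟨hx.1.le, hx.2⟩
  refine (intervalIntegral.hasDerivAt_integral_of_dominated_loc_of_deriv_le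
    (F := fun t x => g x t) (F' := fun t x => g' x t) (bound := fun _ => M)
    (s := Ioo t₀ (t + 1)) (Ioo_mem_nhds ht (by linarith)) ?_ ?_ ?_ ?_ ?_ ?_).2
  · filter_upwards [Ioi_mem_nhds ht] with s hs
    exact (ii (slice hg (le_of_lt hs))).aestronglyMeasurable_restrict_uIoc
  · exact ii (slice hg ht.le)
  · exact (ii (slice hg' ht.le)).aestronglyMeasurable_restrict_uIoc
  · exact Eventually.of_forall fun x hx s hs => hM x (hI x hx) s ⟨hs.1.le, hs.2.le⟩
  · simp
  · exact Eventually.of_forall fun x hx s hs => hd x (hI x hx) s hs.1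

lemma slope_tendsto {g g' h h' : ℝ → ℝ → ℝ} {t₀ : ℝ}
    (hg : ContinuousOn (Function.uncurry g) (Icc 0 π ×ˢ Ici t₀))
    (hg' : ContinuousOn (Function.uncurry g') (Icc 0 π ×ˢ Ici t₀))
    (hd : ∀ x ∈ Icc (0:ℝ) π, ∀ t, t₀ < t → HasDerivAt (fun s => g x s) (g' x t) t)
    (hh : ContinuousOn (Function.uncurry h) (Icc 0 π ×ˢ Ici t₀))
    (hh' : ContinuousOn (Function.uncurry h') (Icc 0 π ×ˢ Ici t₀))
    (he : ∀ x ∈ Icc (0:ℝ) π, ∀ t, t₀ < t → HasDerivAt (fun s => h x s) (h' x t) t)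
    {t : ℝ} (ht : t₀ < t) :
    Tendsto (fun s => ∫ x in (0:ℝ)..π, slope (g x) t s * slope (h x) t s)
      (nhdsWithin t {t}ᶜ) (nhds (∫ x in (0:ℝ)..π, g' x t * h' x t)) := by
  have hI : ∀ x, x ∈ uIoc 0 π → x ∈ Icc 0 π := by
    intro x hx
    rw [uIoc_of_le pi_pos.le] at hx
    exact ⟨hx.1.le, hx.2⟩
  have B : ∀ (g g' : ℝ → ℝ → ℝ), ContinuousOn (Function.uncurry g') (Icc 0 π ×ˢ Ici t₀) →
    (∀ x ∈ Icc (0:ℝ) π, ∀ t, t₀ < t → HasDerivAt (fun s => g x s) (g' x t) t) →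
    ∃ M, 0 ≤ M ∧ ∀ x ∈ Icc (0:ℝ) π, ∀ s ∈ Ioo t₀ (t+1), |slope (g x) t s| ≤ M := by
    intro g g' hg' hd
    obtain ⟨M, hM⟩ := bdd hg' (t + 1)
    have hM0 : 0 ≤ M := (abs_nonneg _).trans (hM 0 ⟨le_rfl, pi_pos.le⟩ t ⟨ht.le, by linarith⟩)
    refine ⟨M, hM0, fun x hx s hs => ?_⟩
    have := Convex.norm_image_sub_le_of_norm_hasDerivWithin_le (f := g x) (f' := g' x)
      (s := Ioo t₀ (t+1)) (C := M) (x := t) (y := s)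
      (fun r hr => (hd x hx r hr.1).hasDerivWithinAt)
      (fun r hr => hM x hx r ⟨hr.1.le, hr.2.le⟩) (convex_Ioo _ _) ⟨ht, by linarith⟩ hs
    rw [slope_def_field, abs_div]
    simp only [Real.norm_eq_abs] at this
    exact div_le_of_le_mul₀ (abs_nonneg _) hM0 this
  obtain ⟨M, hM0, hM⟩ := B g g' hg' hd
  obtain ⟨N, hN0, hN⟩ := B h h' hh' he
  apply intervalIntegral.tendsto_integral_filter_of_dominated_convergence (fun _ => M * N)
  · filter_upwards [nhdsWithin_le_nhds (Ioi_mem_nhds ht)] with s hs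
    have a1 := slice hg ht.le
    have a2 := slice hg (le_of_lt hs)
    have a3 := slice hh ht.le
    have a4 := slice hh (le_of_lt hs)
    simp only [slope_def_field]
    exact (ii (by fun_prop)).aestronglyMeasurable_restrict_uIoc
  · filter_upwards [nhdsWithin_le_nhds (Ioo_mem_nhds ht (by linarith : t < t + 1))] with s hs
    refine Eventually.of_forall fun x hx => ?_
    rw [norm_mul]
    exact mul_le_mul (hM x (hI x hx) s hs) (hN x (hI x hx) s hs) (abs_nonneg _) hM0
  · simp
  · refine Eventually.of_forall fun x hx => ?_
    exact ((hd x (hI x hx) t ht).tendsto_slope).mul ((he x (hI x hx) t ht).tendsto_slope)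

/-- If `F' ≤ k` near 0 then `z F(z) ≤ k z²`. -/
lemma zF {F F' : ℝ → ℝ} {k ρ : ℝ} (hF : ∀ z, HasDerivAt F (F' z) z) (h0 : F 0 = 0)
    (hk : ∀ z, |z| < ρ → F' z ≤ k) {z : ℝ} (hz : |z| < ρ) : z * F z ≤ k * z ^ 2 := by
  have hanti : AntitoneOn (fun s => z * F (s * z) - k * s * z ^ 2) (Icc 0 1) := by
    have hd : ∀ s, HasDerivAt (fun s => z * F (s * z) - k * s * z ^ 2)
        (z * (F' (s * z) * z) - k * z ^ 2) s := by
      intro s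
      have h1 : HasDerivAt (fun s : ℝ => s * z) z s := by
        simpa using (hasDerivAt_id s).mul_const z
      have h2 := ((hF (s * z)).comp s h1).const_mul z
      have h3 := ((hasDerivAt_id s).const_mul k).mul_const (z ^ 2)
      exact (h2.sub h3).congr_deriv (by simp)
    apply antitoneOn_of_deriv_nonpos (convex_Icc 0 1)
    · exact fun s _ => (hd s).continuousAt.continuousWithinAt
    · exact fun s _ => (hd s).differentiableAt.differentiableWithinAt
    · intro s hs
      rw [interior_Icc] at hs
      rw [(hd s).deriv]
      have : F' (s * z) ≤ k := by
        apply hk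
        rw [abs_mul, abs_of_pos hs.1]
        nlinarith [abs_nonneg z, hs.1, hs.2]
      nlinarith [sq_nonneg z]
  have := hanti (left_mem_Icc.2 zero_le_one) (right_mem_Icc.2 zero_le_one) zero_le_one
  simp [h0] at this
  linarith

noncomputable def Phi (F : ℝ → ℝ) (z : ℝ) : ℝ := ∫ s in (0:ℝ)..z, F s

lemma Phi_deriv {F : ℝ → ℝ} (hF : Continuous F) (z : ℝ) : HasDerivAt (Phi F) (F z) z :=
  intervalIntegral.integral_hasDerivAt_right (hF.intervalIntegrable _ _)
    (hF.stronglyMeasurableAtFilter _ _) hF.continuousAt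

lemma Phi_le {F : ℝ → ℝ} {k ρ : ℝ} (hF : Continuous F)
    (hk : ∀ z, |z| < ρ → z * F z ≤ k * z ^ 2) {z : ℝ} (hz : |z| < ρ) :
    Phi F z ≤ k * z ^ 2 / 2 := by
  have hanti : AntitoneOn (fun s => Phi F (s * z) - k * s ^ 2 * z ^ 2 / 2) (Icc 0 1) := by
    have hd : ∀ s, HasDerivAt (fun s => Phi F (s * z) - k * s ^ 2 * z ^ 2 / 2)
        (F (s * z) * z - k * s * z ^ 2) s := by
      intro s
      have h1 : HasDerivAt (fun s : ℝ => s * z) z s := by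
        simpa using (hasDerivAt_id s).mul_const z
      have h2 := ((Phi_deriv hF (s * z)).comp s h1)
      have h3 := ((((hasDerivAt_id s).pow 2).const_mul k).mul_const (z ^ 2)).div_const 2
      exact (h2.sub h3).congr_deriv (by simp; ring)
    apply antitoneOn_of_deriv_nonpos (convex_Icc 0 1)
    · exact fun s _ => (hd s).continuousAt.continuousWithinAt
    · exact fun s _ => (hd s).differentiableAt.differentiableWithinAt
    · intro s hs
      rw [interior_Icc] at hs
      rw [(hd s).deriv]
      have := hk (s * z) (by
        rw [abs_mul, abs_of_pos hs.1]
        nlinarith [abs_nonneg z, hs.1, hs.2])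
      have h2 : s * (F (s * z) * z - k * s * z ^ 2) ≤ 0 := by nlinarith
      by_contra hcon
      push Not at hcon
      nlinarith [mul_pos hs.1 hcon]
  have := hanti (left_mem_Icc.2 zero_le_one) (right_mem_Icc.2 zero_le_one) zero_le_one
  have h00 : Phi F 0 = 0 := by simp [Phi]
  simp [h00] at this
  linarith

lemma aterm {a A μ e w v u θ γ : ℝ} (ha : 0 ≤ a) (haA : a ≤ A) (hμ : 0 < μ)
    (hγ : A / (4 * μ) + A * θ ^ 2 / 4 ≤ γ) :
    a * (e * w * v - (1 + γ) * v ^ 2 - θ * u * v) ≤ μ * (e * w) ^ 2 + u ^ 2 := by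
  have h1 : a * (e * w * v) ≤ μ * (e * w) ^ 2 + a * (A / (4 * μ)) * v ^ 2 := by
    have : a * (a / (4 * μ)) * v ^ 2 ≤ a * (A / (4 * μ)) * v ^ 2 := by gcongr
    have h : 0 ≤ μ * (e * w - a * v / (2 * μ)) ^ 2 := by positivity
    have e1 : μ * (e * w - a * v / (2 * μ)) ^ 2
      = μ * (e * w) ^ 2 - a * (e * w * v) + a * (a / (4 * μ)) * v ^ 2 := by
      field_simp; ring
    linarith
  have h2 : - (a * (θ * u * v)) ≤ u ^ 2 + a * (A * θ ^ 2 / 4) * v ^ 2 := by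
    have : a * (a * θ ^ 2 / 4) * v ^ 2 ≤ a * (A * θ ^ 2 / 4) * v ^ 2 := by gcongr
    nlinarith [sq_nonneg (u + a * θ * v / 2)]
  have h3 : a * v ^ 2 * (A / (4 * μ) + A * θ ^ 2 / 4) ≤ a * v ^ 2 * γ := by gcongr
  have h4 : 0 ≤ a * v ^ 2 := by positivity
  nlinarith

lemma dissip {u v w z s a f : ℝ → ℝ} {e e' C a' k μ θ γ c c' A E : ℝ}
    (hu : ContinuousOn u (Icc 0 π)) (hv : ContinuousOn v (Icc 0 π))
    (hw : ContinuousOn w (Icc 0 π)) (hz : ContinuousOn z (Icc 0 π))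
    (hs : ContinuousOn s (Icc 0 π)) (hf : ContinuousOn f (Icc 0 π))
    (pde : ∀ x ∈ Ioo (0:ℝ) π, -e * z x + s x - C * w x + a' * v x = f x - a x * v x)
    (ha : ∀ x ∈ Ioo (0:ℝ) π, 0 ≤ a x) (haA : ∀ x ∈ Ioo (0:ℝ) π, a x ≤ A)
    (sym : ∫ x in (0:ℝ)..π, u x * z x = ∫ x in (0:ℝ)..π, v x * w x)
    (hD : ∫ x in (0:ℝ)..π, v x * z x ≤ - ∫ x in (0:ℝ)..π, v x ^ 2)
    (hE : ∫ x in (0:ℝ)..π, u x * w x = - E)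
    (hUE : ∫ x in (0:ℝ)..π, u x ^ 2 ≤ E)
    (hwf : - ∫ x in (0:ℝ)..π, w x * f x ≤ k * E)
    (huf : ∀ x ∈ Ioo (0:ℝ) π, u x * f x ≤ k * u x ^ 2)
    (hc : c = C * (1 + γ) - e' + e * (a' + θ))
    (hμ : 0 < μ) (hγ : A / (4 * μ) + A * θ ^ 2 / 4 ≤ γ) (hγ0 : 0 ≤ γ) (he : 0 ≤ e)
    (hθ : 0 ≤ θ) (hk : 0 ≤ k)
    (hdiss : μ * (1 + e) ≤ C - e')
    (hT : θ ≤ (1 + γ) * a' + γ * e)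
    (hEc : k * e + c' / 2 - θ * C + 1 + θ * k ≤ 0) :
    ∫ x in (0:ℝ)..π, ((e * w x - v x) * (e' * w x + e * z x - s x) + γ * v x * s x
      - c' / 2 * (u x * w x) - c / 2 * (v x * w x + u x * z x) + a' * θ * u x * v x
      + θ * (v x ^ 2 + u x * s x) - (1 + γ) * f x * v x) ≤ 0 := by
  have key : ∫ x in (0:ℝ)..π, ((e * w x - v x) * (e' * w x + e * z x - s x) + γ * v x * s x
      - c' / 2 * (u x * w x) - c / 2 * (v x * w x + u x * z x) + a' * θ * u x * v x
      + θ * (v x ^ 2 + u x * s x) - (1 + γ) * f x * v x) ≤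
      ∫ x in (0:ℝ)..π, ((c / 2 - e * θ) * (v x * w x) - (c / 2 - e * θ) * (u x * z x)
        + γ * e * (v x * z x) - e * (w x * f x) + (θ * C - c' / 2) * (u x * w x)
        + (θ - (1 + γ) * a') * v x ^ 2 + (e ^ 2 * μ - e * (C - e')) * w x ^ 2
        + (1 + θ * k) * u x ^ 2) := by
    apply intervalIntegral.integral_mono_on_of_le_Ioo pi_pos.le
    · apply ii; fun_prop
    · apply ii; fun_prop
    · intro x hx
      have h1 := aterm (e := e) (w := w x) (v := v x) (u := u x) (ha x hx) (haA x hx) hμ hγ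
      have h2 := mul_le_mul_of_nonneg_left (huf x hx) hθ
      have h3 : s x = e * z x + C * w x - a' * v x + f x - a x * v x := by linarith [pde x hx]
      rw [h3, hc]
      nlinarith
  refine key.trans ?_
  rw [intervalIntegral.integral_add (ii (by fun_prop)) (ii (by fun_prop)),
    intervalIntegral.integral_add (ii (by fun_prop)) (ii (by fun_prop)),
    intervalIntegral.integral_add (ii (by fun_prop)) (ii (by fun_prop)),
    intervalIntegral.integral_add (ii (by fun_prop)) (ii (by fun_prop)),
    intervalIntegral.integral_sub (ii (by fun_prop)) (ii (by fun_prop)),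
    intervalIntegral.integral_add (ii (by fun_prop)) (ii (by fun_prop)),
    intervalIntegral.integral_sub (ii (by fun_prop)) (ii (by fun_prop))]
  simp only [intervalIntegral.integral_const_mul]
  rw [sym, hE]
  have hX : 0 ≤ ∫ x in (0:ℝ)..π, w x ^ 2 :=
    intervalIntegral.integral_nonneg pi_pos.le fun x _ => sq_nonneg _
  have hT0 : 0 ≤ ∫ x in (0:ℝ)..π, v x ^ 2 :=
    intervalIntegral.integral_nonneg pi_pos.le fun x _ => sq_nonneg _
  have hU0 : 0 ≤ ∫ x in (0:ℝ)..π, u x ^ 2 :=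
    intervalIntegral.integral_nonneg pi_pos.le fun x _ => sq_nonneg _
  have b1 := mul_le_mul_of_nonneg_left hD (mul_nonneg hγ0 he)
  have b2 := mul_le_mul_of_nonneg_left hwf he
  have b3 := mul_le_mul_of_nonneg_left hUE (by positivity : 0 ≤ 1 + θ * k)
  have b4 : (e ^ 2 * μ - e * (C - e')) * ∫ x in (0:ℝ)..π, w x ^ 2 ≤ 0 := by
    apply mul_nonpos_of_nonpos_of_nonneg _ hX
    nlinarith [mul_le_mul_of_nonneg_left hdiss he, mul_nonneg hμ.le he]
  have b5 := mul_nonpos_of_nonpos_of_nonneg hEc (hU0.trans hUE)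
  have b6 := mul_le_mul_of_nonneg_right hT hT0
  nlinarith

lemma lower {u v w p y : ℝ → ℝ} {e a' k μ θ γ c Cbar m : ℝ}
    (hu : ContinuousOn u (Icc 0 π)) (hv : ContinuousOn v (Icc 0 π))
    (hw : ContinuousOn w (Icc 0 π)) (hp : ContinuousOn p (Icc 0 π))
    (hy : ContinuousOn y (Icc 0 π))
    (hE : ∫ x in (0:ℝ)..π, u x * w x = - ∫ x in (0:ℝ)..π, y x ^ 2)
    (hUE : ∫ x in (0:ℝ)..π, u x ^ 2 ≤ ∫ x in (0:ℝ)..π, y x ^ 2)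
    (hpk : ∀ x ∈ Icc (0:ℝ) π, p x ≤ k * u x ^ 2 / 2)
    (hc : γ * Cbar + μ ≤ c) (hm : m = μ + Cbar - 2 * k) (hm0 : 0 < m)
    (hγ1 : 1 ≤ γ) (hγ : 2 * θ ^ 2 / m + 2 ≤ γ) (ha' : 0 ≤ a') (hk : 0 ≤ k) (hkC : k ≤ Cbar)
    (hθ : 0 ≤ θ) :
    min (1/2) (m / 4) * (∫ x in (0:ℝ)..π, (e ^ 2 * w x ^ 2 + y x ^ 2 + u x ^ 2 + v x ^ 2)) ≤
    ∫ x in (0:ℝ)..π, ((e * w x - v x) ^ 2 + γ * v x ^ 2 - c * (u x * w x) + a' * θ * u x ^ 2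
      + 2 * θ * u x * v x - 2 * (1 + γ) * p x) := by
  have key : ∫ x in (0:ℝ)..π, (1 / 2 * (e ^ 2 * w x ^ 2) + v x ^ 2 - c * (u x * w x)
      - (m / 2 + (1 + γ) * k) * u x ^ 2) ≤
      ∫ x in (0:ℝ)..π, ((e * w x - v x) ^ 2 + γ * v x ^ 2 - c * (u x * w x) + a' * θ * u x ^ 2
      + 2 * θ * u x * v x - 2 * (1 + γ) * p x) := by
    apply intervalIntegral.integral_mono_on pi_pos.le
    · apply ii; fun_prop
    · apply ii; fun_prop
    · intro x hx
      have h1 := mul_le_mul_of_nonneg_left (hpk x hx) (by linarith : 0 ≤ 2 * (1 + γ))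
      have h2 : 0 ≤ a' * θ * u x ^ 2 := by positivity
      have h3 : - (2 * θ * u x * v x) ≤ m / 2 * u x ^ 2 + 2 * θ ^ 2 / m * v x ^ 2 := by
        have h : 0 ≤ m / 2 * (u x + 2 * θ / m * v x) ^ 2 := by positivity
        have e1 : m / 2 * (u x + 2 * θ / m * v x) ^ 2 =
          m / 2 * u x ^ 2 + 2 * θ ^ 2 / m * v x ^ 2 + 2 * θ * u x * v x := by
          field_simp; ring
        linarith
      have h4 := mul_le_mul_of_nonneg_right hγ (sq_nonneg (v x))
      nlinarith [sq_nonneg (e * w x - 2 * v x)]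
  refine le_trans ?_ key
  rw [intervalIntegral.integral_sub (ii (by fun_prop)) (ii (by fun_prop)),
    intervalIntegral.integral_sub (ii (by fun_prop)) (ii (by fun_prop)),
    intervalIntegral.integral_add (ii (by fun_prop)) (ii (by fun_prop)),
    intervalIntegral.integral_add (ii (by fun_prop)) (ii (by fun_prop)),
    intervalIntegral.integral_add (ii (by fun_prop)) (ii (by fun_prop)),
    intervalIntegral.integral_add (ii (by fun_prop)) (ii (by fun_prop))]
  simp only [intervalIntegral.integral_const_mul]
  rw [hE]
  have hX : 0 ≤ ∫ x in (0:ℝ)..π, w x ^ 2 :=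
    intervalIntegral.integral_nonneg pi_pos.le fun x _ => sq_nonneg _
  have hT0 : 0 ≤ ∫ x in (0:ℝ)..π, v x ^ 2 :=
    intervalIntegral.integral_nonneg pi_pos.le fun x _ => sq_nonneg _
  have hU0 : 0 ≤ ∫ x in (0:ℝ)..π, u x ^ 2 :=
    intervalIntegral.integral_nonneg pi_pos.le fun x _ => sq_nonneg _
  set W := ∫ x in (0:ℝ)..π, w x ^ 2
  set T := ∫ x in (0:ℝ)..π, v x ^ 2
  set U := ∫ x in (0:ℝ)..π, u x ^ 2
  set E := ∫ x in (0:ℝ)..π, y x ^ 2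
  have hE0 : 0 ≤ E := hU0.trans hUE
  have c1 : min (1/2) (m / 4) ≤ 1 / 2 := min_le_left _ _
  have c2 : min (1/2) (m / 4) ≤ m / 4 := min_le_right _ _
  set q := min (1/2) (m / 4)
  have hW : 0 ≤ e ^ 2 * W := by positivity
  have d1 := mul_le_mul_of_nonneg_right c1 hW
  have d2 := mul_le_mul_of_nonneg_right c1 hT0
  have d3 := mul_le_mul_of_nonneg_right c2 hE0
  have d4 := mul_le_mul_of_nonneg_right c2 hU0
  have d5 := mul_le_mul_of_nonneg_right hc hE0
  have d6 := mul_le_mul_of_nonneg_left hUE (by positivity : 0 ≤ m / 4 + (m / 2 + (1 + γ) * k))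
  have d7 : 0 ≤ (γ - 1) * (Cbar - k) * E :=
    mul_nonneg (mul_nonneg (by linarith) (by linarith)) hE0
  have d8 : 0 ≤ m * E := by positivity
  have d9 : (μ + Cbar - 2 * k) * E = m * E := by rw [hm]
  nlinarith

lemma upper {u v w p y : ℝ → ℝ} {e a' M θ γ c : ℝ}
    (hu : ContinuousOn u (Icc 0 π)) (hv : ContinuousOn v (Icc 0 π))
    (hw : ContinuousOn w (Icc 0 π)) (hp : ContinuousOn p (Icc 0 π))
    (hy : ContinuousOn y (Icc 0 π))
    (hE : ∫ x in (0:ℝ)..π, u x * w x = - ∫ x in (0:ℝ)..π, y x ^ 2)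
    (hpk : ∀ x ∈ Icc (0:ℝ) π, - p x ≤ M * u x ^ 2 / 2) (hM : 0 ≤ M)
    (hγ1 : 1 ≤ γ) (ha' : 0 ≤ a') (hθ : 0 ≤ θ) :
    ∫ x in (0:ℝ)..π, ((e * w x - v x) ^ 2 + γ * v x ^ 2 - c * (u x * w x) + a' * θ * u x ^ 2
      + 2 * θ * u x * v x - 2 * (1 + γ) * p x) ≤
    (2 + γ + θ + |c| + a' * θ + (1 + γ) * M) *
      (∫ x in (0:ℝ)..π, (e ^ 2 * w x ^ 2 + y x ^ 2 + u x ^ 2 + v x ^ 2)) := by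
  have key : ∫ x in (0:ℝ)..π, ((e * w x - v x) ^ 2 + γ * v x ^ 2 - c * (u x * w x)
      + a' * θ * u x ^ 2 + 2 * θ * u x * v x - 2 * (1 + γ) * p x) ≤
      ∫ x in (0:ℝ)..π, (2 * (e ^ 2 * w x ^ 2) + (2 + γ + θ) * v x ^ 2 - c * (u x * w x)
      + (a' * θ + θ + (1 + γ) * M) * u x ^ 2) := by
    apply intervalIntegral.integral_mono_on pi_pos.le
    · apply ii; fun_prop
    · apply ii; fun_prop
    · intro x hx
      have h1 := mul_le_mul_of_nonneg_left (hpk x hx) (by linarith : 0 ≤ 2 * (1 + γ))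
      have h2 := mul_nonneg hθ (sq_nonneg (u x - v x))
      nlinarith [sq_nonneg (e * w x + v x)]
  refine le_trans key ?_
  rw [intervalIntegral.integral_add (ii (by fun_prop)) (ii (by fun_prop)),
    intervalIntegral.integral_sub (ii (by fun_prop)) (ii (by fun_prop)),
    intervalIntegral.integral_add (ii (by fun_prop)) (ii (by fun_prop)),
    intervalIntegral.integral_add (ii (by fun_prop)) (ii (by fun_prop)),
    intervalIntegral.integral_add (ii (by fun_prop)) (ii (by fun_prop)),
    intervalIntegral.integral_add (ii (by fun_prop)) (ii (by fun_prop))]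
  simp only [intervalIntegral.integral_const_mul]
  rw [hE]
  have hX : 0 ≤ ∫ x in (0:ℝ)..π, w x ^ 2 :=
    intervalIntegral.integral_nonneg pi_pos.le fun x _ => sq_nonneg _
  have hT0 : 0 ≤ ∫ x in (0:ℝ)..π, v x ^ 2 :=
    intervalIntegral.integral_nonneg pi_pos.le fun x _ => sq_nonneg _
  have hU0 : 0 ≤ ∫ x in (0:ℝ)..π, u x ^ 2 :=
    intervalIntegral.integral_nonneg pi_pos.le fun x _ => sq_nonneg _
  have hE0 : 0 ≤ ∫ x in (0:ℝ)..π, y x ^ 2 :=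
    intervalIntegral.integral_nonneg pi_pos.le fun x _ => sq_nonneg _
  set W := ∫ x in (0:ℝ)..π, w x ^ 2
  set T := ∫ x in (0:ℝ)..π, v x ^ 2
  set U := ∫ x in (0:ℝ)..π, u x ^ 2
  set E := ∫ x in (0:ℝ)..π, y x ^ 2
  have hW : 0 ≤ e ^ 2 * W := by positivity
  have q1 : 0 ≤ a' * θ := by positivity
  have q2 : 0 ≤ (1 + γ) * M := by positivity
  have q3 := abs_nonneg c
  set g := |c|
  have q4 : c ≤ g := le_abs_self c
  have d1 : 2 * (e ^ 2 * W) ≤ (2 + γ + θ + g + a' * θ + (1 + γ) * M) * (e ^ 2 * W) := by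
    apply mul_le_mul_of_nonneg_right _ hW; linarith
  have d2 : (2 + γ + θ) * T ≤ (2 + γ + θ + g + a' * θ + (1 + γ) * M) * T := by
    apply mul_le_mul_of_nonneg_right _ hT0; linarith
  have d3 : c * E ≤ (2 + γ + θ + g + a' * θ + (1 + γ) * M) * E := by
    apply mul_le_mul_of_nonneg_right _ hE0; linarith
  have d4 : (a' * θ + θ + (1 + γ) * M) * U ≤ (2 + γ + θ + g + a' * θ + (1 + γ) * M) * U := by
    apply mul_le_mul_of_nonneg_right _ hU0; linarith
  linarith

section sol
variable {ε C F : ℝ → ℝ} {a' t₀ : ℝ} (S : ClassicalSolution ε C F a' t₀)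

lemma hasD_u {x t : ℝ} (hx : x ∈ Icc (0:ℝ) π) (ht : t₀ < t) :
    HasDerivAt (fun s => S.u x s) (S.ut x t) t :=
  (S.hut x hx t ht.le).hasDerivAt (Ici_mem_nhds ht)

lemma hasD_ut {x t : ℝ} (hx : x ∈ Icc (0:ℝ) π) (ht : t₀ < t) :
    HasDerivAt (fun s => S.ut x s) (S.utt x t) t :=
  (S.hutt x hx t ht.le).hasDerivAt (Ici_mem_nhds ht)

lemma hasD_uxx {x t : ℝ} (hx : x ∈ Icc (0:ℝ) π) (ht : t₀ < t) :
    HasDerivAt (fun s => S.uxx x s) (S.uxxt x t) t :=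
  (S.huxxt x hx t ht.le).hasDerivAt (Ici_mem_nhds ht)

lemma green {s r : ℝ} (hs : t₀ ≤ s) (hr : t₀ ≤ r) :
    ∫ x in (0:ℝ)..π, S.u x s * S.uxx x r = - ∫ x in (0:ℝ)..π, S.ux x s * S.ux x r :=
  ibp (S.hux s hs) (S.huxx r hr) (slice S.cont_ux hs) (slice S.cont_uxx hr)
    (S.bc0 s hs) (S.bcπ s hs)

lemma green_sq {t : ℝ} (ht : t₀ ≤ t) :
    ∫ x in (0:ℝ)..π, S.u x t * S.uxx x t = - ∫ x in (0:ℝ)..π, S.ux x t ^ 2 := by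
  rw [green S ht ht]
  simp only [sq]

lemma poin {t : ℝ} (ht : t₀ ≤ t) :
    ∫ x in (0:ℝ)..π, S.u x t ^ 2 ≤ ∫ x in (0:ℝ)..π, S.ux x t ^ 2 :=
  poincare (S.hux t ht) (slice S.cont_ux ht) (S.bc0 t ht) (S.bcπ t ht)

lemma sym {t : ℝ} (ht : t₀ < t) :
    ∫ x in (0:ℝ)..π, S.u x t * S.uxxt x t = ∫ x in (0:ℝ)..π, S.ut x t * S.uxx x t := by
  have cu := slice S.cont_u ht.le
  have cw := slice S.cont_uxx ht.le
  have prj : ContinuousOn (fun p : ℝ × ℝ => p.1) (Icc 0 π ×ˢ Ici t₀) := by fun_prop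
  have mp : MapsTo (fun p : ℝ × ℝ => p.1) (Icc 0 π ×ˢ Ici t₀) (Icc 0 π) := fun p hp => hp.1
  have h1 : HasDerivAt (fun s => ∫ x in (0:ℝ)..π, S.u x t * S.uxx x s)
      (∫ x in (0:ℝ)..π, S.u x t * S.uxxt x t) t :=
    deriv_param (g := fun x s => S.u x t * S.uxx x s) (g' := fun x s => S.u x t * S.uxxt x s)
      ((cu.comp prj mp).mul S.cont_uxx) ((cu.comp prj mp).mul S.cont_uxxt)
      (fun x hx s hs => (hasD_uxx S hx hs).const_mul _) ht
  have h2 : HasDerivAt (fun s => ∫ x in (0:ℝ)..π, S.u x s * S.uxx x t)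
      (∫ x in (0:ℝ)..π, S.ut x t * S.uxx x t) t :=
    deriv_param (g := fun x s => S.u x s * S.uxx x t) (g' := fun x s => S.ut x s * S.uxx x t)
      (S.cont_u.mul (cw.comp prj mp)) (S.cont_ut.mul (cw.comp prj mp))
      (fun x hx s hs => (hasD_u S hx hs).mul_const _) ht
  refine h1.unique (h2.congr_of_eventuallyEq ?_)
  filter_upwards [Ioi_mem_nhds ht] with s hs
  rw [green S ht.le (le_of_lt hs), green S (le_of_lt hs) ht.le]
  simp only [mul_comm]

lemma dissD {t : ℝ} (ht : t₀ < t) :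
    ∫ x in (0:ℝ)..π, S.ut x t * S.uxxt x t ≤ - ∫ x in (0:ℝ)..π, S.ut x t ^ 2 := by
  have h1 := slope_tendsto S.cont_u S.cont_ut (fun x hx s hs => hasD_u S hx hs)
    S.cont_uxx S.cont_uxxt (fun x hx s hs => hasD_uxx S hx hs) ht
  have h2 := slope_tendsto S.cont_u S.cont_ut (fun x hx s hs => hasD_u S hx hs)
    S.cont_u S.cont_ut (fun x hx s hs => hasD_u S hx hs) ht
  have h3 : ∫ x in (0:ℝ)..π, S.ut x t * S.uxxt x t ≤ - ∫ x in (0:ℝ)..π, S.ut x t * S.ut x t := by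
    refine le_of_tendsto_of_tendsto h1 h2.neg ?_
    filter_upwards [nhdsWithin_le_nhds (Ioi_mem_nhds ht)] with s hs
    have hs' : t₀ ≤ s := le_of_lt hs
    have d1 : ∀ x ∈ Icc (0:ℝ) π, HasDerivWithinAt (fun x => slope (S.u x) t s)
        ((S.ux x s - S.ux x t) / (s - t)) (Icc 0 π) x := by
      intro x hx
      simp only [slope_def_field]
      exact ((S.hux s hs' x hx).sub (S.hux t ht.le x hx)).div_const _
    have d2 : ∀ x ∈ Icc (0:ℝ) π, HasDerivWithinAt (fun x => (S.ux x s - S.ux x t) / (s - t))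
        (slope (S.uxx x) t s) (Icc 0 π) x := by
      intro x hx
      simp only [slope_def_field]
      exact ((S.huxx s hs' x hx).sub (S.huxx t ht.le x hx)).div_const _
    have c1 : ContinuousOn (fun x => (S.ux x s - S.ux x t) / (s - t)) (Icc 0 π) :=
      fun x hx => (d2 x hx).continuousWithinAt
    have c2 : ContinuousOn (fun x => slope (S.uxx x) t s) (Icc 0 π) := by
      simp only [slope_def_field]
      exact ((slice S.cont_uxx hs').sub (slice S.cont_uxx ht.le)).div_const _
    have b0 : slope (S.u 0) t s = 0 := by
      rw [slope_def_field, S.bc0 s hs', S.bc0 t ht.le]; simp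
    have b1 : slope (S.u π) t s = 0 := by
      rw [slope_def_field, S.bcπ s hs', S.bcπ t ht.le]; simp
    have k1 := ibp d1 d2 c1 c2 b0 b1
    have k2 := poincare d1 c1 b0 b1
    rw [k1]
    simp only [← sq]
    linarith
  simpa only [sq] using h3

/-- Lyapunov density (twice the usual one). -/
noncomputable def G (γ θ : ℝ) (c : ℝ → ℝ) (x t : ℝ) : ℝ :=
  (ε t * S.uxx x t - S.ut x t) ^ 2 + γ * S.ut x t ^ 2 - c t * (S.u x t * S.uxx x t)
    + a' * θ * S.u x t ^ 2 + 2 * θ * S.u x t * S.ut x t - 2 * (1 + γ) * Phi F (S.u x t)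

/-- Its time derivative. -/
noncomputable def Gt (ε' : ℝ → ℝ) (γ θ : ℝ) (c c' : ℝ → ℝ) (x t : ℝ) : ℝ :=
  2 * ((ε t * S.uxx x t - S.ut x t) * (ε' t * S.uxx x t + ε t * S.uxxt x t - S.utt x t)
    + γ * S.ut x t * S.utt x t
      - c' t / 2 * (S.u x t * S.uxx x t) - c t / 2 * (S.ut x t * S.uxx x t + S.u x t * S.uxxt x t)
      + a' * θ * S.u x t * S.ut x t
      + θ * (S.ut x t ^ 2 + S.u x t * S.utt x t) - (1 + γ) * F (S.u x t) * S.ut x t)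

lemma cont_time {c : ℝ → ℝ} (hc : ContinuousOn c (Ici t₀)) :
    ContinuousOn (fun p : ℝ × ℝ => c p.2) (Icc 0 π ×ˢ Ici t₀) :=
  hc.comp (by fun_prop) fun _ hp => hp.2

lemma G_cont {γ θ : ℝ} {c : ℝ → ℝ} (hF : Continuous F) (hc : ContinuousOn c (Ici t₀))
    (hε : ContinuousOn ε (Ici t₀)) :
    ContinuousOn (Function.uncurry (G S γ θ c)) (Icc 0 π ×ˢ Ici t₀) := by
  have h1 := cont_time hc
  have h2 := cont_time hε
  have h3 := S.cont_u
  have h4 := S.cont_ut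
  have h5 := S.cont_uxx
  have hP : Continuous (Phi F) :=
    continuous_iff_continuousAt.2 fun z => (Phi_deriv hF z).continuousAt
  have h6 := hP.comp_continuousOn h3
  exact ((((((h2.mul h5).sub h4).pow 2).add ((h4.pow 2).const_mul γ)).sub (h1.mul (h3.mul h5))).add
    ((h3.pow 2).const_mul (a' * θ))).add ((h3.const_mul (2 * θ)).mul h4) |>.sub
    (h6.const_mul (2 * (1 + γ)))

lemma Gt_cont {γ θ : ℝ} {c c' ε' : ℝ → ℝ} (hF : Continuous F) (hc : ContinuousOn c (Ici t₀))
    (hc' : ContinuousOn c' (Ici t₀))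
    (hε : ContinuousOn ε (Ici t₀)) (hε' : ContinuousOn ε' (Ici t₀)) :
    ContinuousOn (Function.uncurry (Gt S ε' γ θ c c')) (Icc 0 π ×ˢ Ici t₀) := by
  have h1 := cont_time hc
  have h1' := cont_time hc'
  have h2 := cont_time hε
  have h2' := cont_time hε'
  have h3 := S.cont_u
  have h4 := S.cont_ut
  have h5 := S.cont_uxx
  have h7 := S.cont_utt
  have h8 := S.cont_uxxt
  have h6 := hF.comp_continuousOn h3
  exact ContinuousOn.const_mul (((((((((h2.mul h5).sub h4).mul (((h2'.mul h5).add
    (h2.mul h8)).sub h7)).add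
    ((h4.const_mul γ).mul h7)).sub ((h1'.div_const 2).mul (h3.mul h5))).sub
    ((h1.div_const 2).mul ((h4.mul h5).add (h3.mul h8)))).add
    ((h3.const_mul (a' * θ)).mul h4)).add
    (((h4.pow 2).add (h3.mul h7)).const_mul θ)).sub ((h6.const_mul (1 + γ)).mul h4)) 2

lemma G_deriv {γ θ : ℝ} {c c' ε' : ℝ → ℝ} (hF : Continuous F) {t x : ℝ} (ht : t₀ < t)
    (hx : x ∈ Icc (0:ℝ) π) (hc : HasDerivAt c (c' t) t) (hε : HasDerivAt ε (ε' t) t) :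
    HasDerivAt (fun s => G S γ θ c x s) (Gt S ε' γ θ c c' x t) t := by
  have h3 := hasD_u S hx ht
  have h4 := hasD_ut S hx ht
  have h5 := hasD_uxx S hx ht
  have h6 := (Phi_deriv hF (S.u x t)).comp t h3
  have := ((((((hε.mul h5).sub h4).pow 2).add ((h4.pow 2).const_mul γ)).sub
    (hc.mul (h3.mul h5))).add
    ((h3.pow 2).const_mul (a' * θ))).add ((h3.const_mul (2 * θ)).mul h4) |>.sub
    (h6.const_mul (2 * (1 + γ)))
  refine this.congr_deriv ?_
  simp only [Gt, Pi.mul_apply, Pi.sub_apply]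
  push_cast
  ring

lemma d_sq {t : ℝ} : S.d t ^ 2 = ∫ x in (0:ℝ)..π,
    ((ε t)^2 * (S.uxx x t)^2 + (S.ux x t)^2 + (S.u x t)^2 + (S.ut x t)^2) := by
  rw [ClassicalSolution.d, Real.sq_sqrt]
  exact intervalIntegral.integral_nonneg pi_pos.le fun x _ => by positivity

lemma d_cont (hε : ContinuousOn ε (Ici t₀)) : ContinuousOn S.d (Ici t₀) := by
  have h2 := cont_time hε
  have h : ContinuousOn (Function.uncurry fun x t =>
    ((ε t)^2 * (S.uxx x t)^2 + (S.ux x t)^2 + (S.u x t)^2 + (S.ut x t)^2)) (Icc 0 π ×ˢ Ici t₀) :=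
    ((((h2.pow 2).mul (S.cont_uxx.pow 2)).add (S.cont_ux.pow 2)).add (S.cont_u.pow 2)).add
      (S.cont_ut.pow 2)
  exact (cont_param h).sqrt

lemma ux_le_d {t : ℝ} (ht : t₀ ≤ t) : ∫ x in (0:ℝ)..π, S.ux x t ^ 2 ≤ S.d t ^ 2 := by
  rw [d_sq]
  have h1 := slice S.cont_u ht
  have h2 := slice S.cont_ux ht
  have h3 := slice S.cont_uxx ht
  have h4 := slice S.cont_ut ht
  apply intervalIntegral.integral_mono_on pi_pos.le (ii (h2.pow 2))
  · exact ii ((((h3.pow 2).const_mul (ε t ^ 2)).add (h2.pow 2)).add (h1.pow 2) |>.add (h4.pow 2))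
  · intro x _
    change S.ux x t ^ 2 ≤ _
    nlinarith [sq_nonneg (ε t * S.uxx x t), sq_nonneg (S.u x t), sq_nonneg (S.ut x t)]

lemma u_small {t x ρ : ℝ} (ht : t₀ ≤ t) (hx : x ∈ Icc (0:ℝ) π) (hρ : 0 < ρ)
    (hd : S.d t ≤ ρ / 2) : |S.u x t| < ρ := by
  have h1 := sup_bound (S.hux t ht) (slice S.cont_ux ht) (S.bc0 t ht) hx
  have h2 := ux_le_d S ht
  have h3 : 0 ≤ S.d t := Real.sqrt_nonneg _
  apply abs_lt_of_sq_lt_sq _ hρ.le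
  have h4 : S.d t ^ 2 ≤ (ρ / 2) ^ 2 := pow_le_pow_left₀ h3 hd 2
  have h5 : π * ∫ y in (0:ℝ)..π, S.ux y t ^ 2 ≤ π * (ρ / 2) ^ 2 :=
    mul_le_mul_of_nonneg_left (h2.trans h4) pi_pos.le
  nlinarith [pi_lt_four, pow_pos hρ 2]

lemma wf {F' : ℝ → ℝ} {k ρ t : ℝ} (hF : ∀ z, HasDerivAt F (F' z) z) (hF' : Continuous F')
    (hF0 : F 0 = 0) (hk : ∀ z, |z| < ρ → F' z ≤ k) (ht : t₀ ≤ t)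
    (hu : ∀ x ∈ Icc (0:ℝ) π, |S.u x t| < ρ) :
    - ∫ x in (0:ℝ)..π, S.uxx x t * F (S.u x t) ≤ k * ∫ x in (0:ℝ)..π, S.ux x t ^ 2 := by
  have h1 := slice S.cont_u ht
  have h2 := slice S.cont_ux ht
  have h3 := slice S.cont_uxx ht
  have c1 : ContinuousOn (fun x => F' (S.u x t) * S.ux x t) (Icc 0 π) :=
    (hF'.comp_continuousOn h1).mul h2
  have := ibp (p := fun x => F (S.u x t)) (p' := fun x => F' (S.u x t) * S.ux x t)
    (fun x hx => (hF (S.u x t)).comp_hasDerivWithinAt x (S.hux t ht x hx)) (S.huxx t ht) c1 h3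
    (by rw [S.bc0 t ht, hF0]) (by rw [S.bcπ t ht, hF0])
  simp only [mul_comm (S.uxx _ t)]
  rw [this, neg_neg, ← intervalIntegral.integral_const_mul]
  apply intervalIntegral.integral_mono_on pi_pos.le (ii (c1.mul h2))
  · exact ii ((h2.pow 2).const_mul k)
  · intro x hx
    have := mul_le_mul_of_nonneg_right (hk _ (hu x hx)) (sq_nonneg (S.ux x t))
    change F' (S.u x t) * S.ux x t * S.ux x t ≤ k * S.ux x t ^ 2
    nlinarith

end sol

end StabAux

set_option maxHeartbeats 2000000

/-- Theorem 3.1 (stability): under the standing hypotheses, if `C'(t) ≤ 0` for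
all `t ≥ 0` or `C'(t) → 0` as `t → ∞`, then the null solution is stable. -/
theorem null_solution_stable
    (ε ε' ε'' C C' F F' : ℝ → ℝ) (a' A τ k ρ μ Cbar εbar ebar : ℝ)
    (hεderiv : ∀ t ∈ Ici (0:ℝ), HasDerivWithinAt ε (ε' t) (Ici 0) t)
    (hε'deriv : ∀ t ∈ Ici (0:ℝ), HasDerivWithinAt ε' (ε'' t) (Ici 0) t)
    (hε''cont : ContinuousOn ε'' (Ici 0))
    (hεnonneg : ∀ t ∈ Ici (0:ℝ), 0 ≤ ε t)
    (hCderiv : ∀ t ∈ Ici (0:ℝ), HasDerivWithinAt C (C' t) (Ici 0) t)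
    (hC'cont : ContinuousOn C' (Ici 0))
    (hFderiv : ∀ z, HasDerivAt F (F' z) z)
    (hF'cont : Continuous F')
    (hF0 : F 0 = 0)
    (hCbar : IsGLB (C '' Ioi (0:ℝ)) Cbar) (hCbarpos : 0 < Cbar)
    (hεbar : IsGLB (ε '' Ioi (0:ℝ)) εbar)
    (hebar : IsGLB (ε'' '' Ioi (0:ℝ)) ebar)
    (hA : 0 ≤ A) (hτ : 0 ≤ τ) (hk : 0 ≤ k) (hρ : 0 < ρ) (hμ : 0 < μ)
    (hFk : ∀ z, |z| < ρ → F' z ≤ k)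
    (hCk : k ≤ Cbar)
    (hdiss : ∀ t ∈ Ici (0:ℝ), μ * (1 + ε t) ≤ C t - ε' t)
    (hmuk : 0 < μ + Cbar / 2 - 2 * k)
    (ha' : 0 ≤ a')
    (ha'ε : 0 < a' + εbar / 2)
    (hC' : (∀ t ∈ Ici (0:ℝ), C' t ≤ 0) ∨ Tendsto C' atTop (nhds 0))
    :
    ∃ ξ, 0 < ξ ∧ ξ ≤ ρ ∧ ∃ κ, 0 ≤ κ ∧
      ∀ σ, 0 < σ → σ ≤ ξ → ∀ t₀, κ ≤ t₀ →
        ∃ δ, 0 < δ ∧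
          ∀ S : ClassicalSolution ε C F a' t₀,
            (∀ x ∈ Icc (0:ℝ) π, ∀ t ∈ Ici t₀, S.aa x t ≤ A * S.d t ^ τ) →
            S.d t₀ < δ → ∀ t, t₀ ≤ t → S.d t < σ := by
  have hFc : Continuous F := continuous_iff_continuousAt.2 fun z => (hFderiv z).continuousAt
  have hCge : ∀ t, 0 < t → Cbar ≤ C t := fun t ht => hCbar.1 ⟨t, ht, rfl⟩
  have hεge : ∀ t, 0 < t → εbar ≤ ε t := fun t ht => hεbar.1 ⟨t, ht, rfl⟩
  have hege : ∀ t, 0 < t → ebar ≤ ε'' t := fun t ht => hebar.1 ⟨t, ht, rfl⟩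
  have hεb0 : 0 ≤ εbar := by
    apply hεbar.2
    rintro _ ⟨t, ht, rfl⟩
    exact hεnonneg t (mem_Ioi.1 ht).le
  obtain ⟨m, hm⟩ : ∃ m, m = μ + Cbar - 2 * k := ⟨_, rfl⟩
  have hm0 : 0 < m := by linarith
  obtain ⟨θ, hθa, hθk, hθm⟩ : ∃ θ, a' ≤ θ ∧ 2 * k ≤ θ * μ ∧ a' * Cbar - ebar + 4 ≤ θ * m := by
    have q1 := le_abs_self (a' * Cbar - ebar + 4)
    have q2 : 0 ≤ 2 * k / μ := by positivity
    have q3 : 0 ≤ |a' * Cbar - ebar + 4| / m := by positivity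
    refine ⟨a' + 2 * k / μ + |a' * Cbar - ebar + 4| / m, by linarith, ?_, ?_⟩
    · have : 2 * k / μ * μ = 2 * k := by field_simp
      nlinarith [mul_nonneg ha' hμ.le, mul_nonneg q3 hμ.le]
    · have : |a' * Cbar - ebar + 4| / m * m = |a' * Cbar - ebar + 4| := by field_simp
      nlinarith [mul_nonneg ha' hm0.le, mul_nonneg q2 hm0.le]
  have hθ : 0 ≤ θ := ha'.trans hθa
  have hb : 0 < a' + εbar := by linarith
  obtain ⟨γ, hγA, hγm, hγT⟩ : ∃ γ, A / (4 * μ) + A * θ ^ 2 / 4 ≤ γ ∧ 2 * θ ^ 2 / m + 2 ≤ γ ∧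
      θ ≤ γ * (a' + εbar) := by
    have q1 : 0 ≤ A / (4 * μ) + A * θ ^ 2 / 4 := by positivity
    have q2 : 0 ≤ 2 * θ ^ 2 / m + 2 := by positivity
    have q3 : 0 ≤ θ / (a' + εbar) := by positivity
    refine ⟨(A / (4 * μ) + A * θ ^ 2 / 4) + (2 * θ ^ 2 / m + 2) + θ / (a' + εbar), by linarith,
      by linarith, ?_⟩
    have : θ / (a' + εbar) * (a' + εbar) = θ := by field_simp
    nlinarith [mul_nonneg q1 hb.le, mul_nonneg q2 hb.le]
  have hγ1 : 1 ≤ γ := by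
    have : 0 ≤ 2 * θ ^ 2 / m := by positivity
    linarith
  obtain ⟨κ, hκ1, hκ⟩ : ∃ κ, 1 ≤ κ ∧ ∀ t, κ ≤ t → (1 + γ) * C' t ≤ 2 := by
    rcases hC' with h | h
    · refine ⟨1, le_rfl, fun t ht => ?_⟩
      have := mul_nonpos_of_nonneg_of_nonpos (by linarith : 0 ≤ 1 + γ)
        (h t (zero_le_one.trans ht))
      linarith
    · have h2 : Tendsto (fun t => (1 + γ) * C' t) atTop (nhds ((1 + γ) * 0)) := h.const_mul _
      rw [mul_zero] at h2
      obtain ⟨b, hb⟩ := eventually_atTop.1 (h2.eventually (ge_mem_nhds (by norm_num : (0:ℝ) < 2)))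
      exact ⟨max 1 b, le_max_left _ _, fun t ht => hb t ((le_max_right _ _).trans ht)⟩
  obtain ⟨c, hc⟩ : ∃ c : ℝ → ℝ, c = fun t => C t * (1 + γ) - ε' t + ε t * (a' + θ) := ⟨_, rfl⟩
  obtain ⟨c', hc'⟩ : ∃ c' : ℝ → ℝ, c' = fun t => C' t * (1 + γ) - ε'' t + ε' t * (a' + θ) :=
    ⟨_, rfl⟩
  have hcC : ∀ t, 0 < t → γ * Cbar + μ ≤ c t := by
    intro t ht
    rw [hc]
    have h1 := hdiss t ht.le
    have h2 := mul_le_mul_of_nonneg_left (hCge t ht) (by linarith : 0 ≤ γ)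
    have h3 := hεnonneg t ht.le
    have h4 := mul_nonneg h3 (by linarith : 0 ≤ a' + θ)
    have h5 := mul_nonneg hμ.le h3
    simp only
    nlinarith
  have hEc : ∀ t, κ ≤ t → k * ε t + c' t / 2 - θ * C t + 1 + θ * k ≤ 0 := by
    intro t ht
    have ht0 : 0 < t := by linarith
    rw [hc']
    simp only
    have h0 := hκ t ht
    have h1 := hege t ht0
    have h2 := mul_le_mul_of_nonneg_left (hdiss t ht0.le) (by linarith : 0 ≤ a' + θ)
    have h3 := hεnonneg t ht0.le
    have h4 := mul_le_mul_of_nonneg_left (hCge t ht0) (by linarith : 0 ≤ θ - a')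
    have h5 := mul_le_mul_of_nonneg_right hθk h3
    have h6 := mul_nonneg ha' (mul_nonneg hμ.le (by linarith : 0 ≤ 1 + ε t))
    rw [hm] at hθm
    nlinarith
  have hγ0 : 0 ≤ γ := by linarith
  have hεc0 : ContinuousOn ε (Ici 0) := fun t ht => (hεderiv t ht).continuousWithinAt
  have hε'c0 : ContinuousOn ε' (Ici 0) := fun t ht => (hε'deriv t ht).continuousWithinAt
  have hCc0 : ContinuousOn C (Ici 0) := fun t ht => (hCderiv t ht).continuousWithinAt
  have hcc0 : ContinuousOn c (Ici 0) := by
    rw [hc]; fun_prop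
  have hc'c0 : ContinuousOn c' (Ici 0) := by
    rw [hc']; fun_prop
  have hcd : ∀ t, 0 < t → HasDerivAt c (c' t) t := by
    intro t ht
    rw [hc, hc']
    have i := Ici_mem_nhds ht
    exact ((((hCderiv t ht.le).hasDerivAt i).mul_const _).sub
      ((hε'deriv t ht.le).hasDerivAt i)).add (((hεderiv t ht.le).hasDerivAt i).mul_const _)
  obtain ⟨M, hM0, hM⟩ : ∃ M, 0 ≤ M ∧ ∀ z, |z| < ρ → - F' z ≤ M := by
    obtain ⟨M, hM⟩ := (isCompact_Icc (a := -ρ) (b := ρ)).exists_bound_of_continuousOn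
      hF'cont.continuousOn
    have hb : ∀ z, |z| < ρ → |F' z| ≤ M := fun z hz =>
      hM z ⟨(abs_lt.1 hz).1.le, (abs_lt.1 hz).2.le⟩
    exact ⟨M, (abs_nonneg _).trans (hb 0 (by simpa using hρ)),
      fun z hz => (neg_le_abs _).trans (hb z hz)⟩
  have hzF : ∀ z, |z| < ρ → z * F z ≤ k * z ^ 2 := fun z hz => StabAux.zF hFderiv hF0 hFk hz
  have hPhi : ∀ z, |z| < ρ → StabAux.Phi F z ≤ k * z ^ 2 / 2 := fun z hz =>
    StabAux.Phi_le hFc hzF hz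
  have hPhi' : ∀ z, |z| < ρ → - StabAux.Phi F z ≤ M * z ^ 2 / 2 := by
    intro z hz
    have h1 : ∀ z, |z| < ρ → z * (fun s => - F s) z ≤ M * z ^ 2 := fun z hz =>
      StabAux.zF (F := fun s => - F s) (F' := fun s => - F' s) (fun z => (hFderiv z).neg)
        (by simp [hF0]) hM hz
    have h2 := StabAux.Phi_le (F := fun s => - F s) hFc.neg h1 hz
    simpa [StabAux.Phi] using h2
  refine ⟨min 1 (ρ / 2), by positivity, (min_le_right _ _).trans (by linarith), κ, by linarith, ?_⟩
  intro σ hσ hσξ t₀ ht₀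
  have hσ1 : σ ≤ 1 := hσξ.trans (min_le_left _ _)
  have hσρ : σ ≤ ρ / 2 := hσξ.trans (min_le_right _ _)
  have ht00 : 0 < t₀ := by linarith
  have hsub : Ici t₀ ⊆ Ici 0 := Ici_subset_Ici.2 ht00.le
  have hεc := hεc0.mono hsub
  obtain ⟨K, hK⟩ : ∃ K, K = 2 + γ + θ + |c t₀| + a' * θ + (1 + γ) * M := ⟨_, rfl⟩
  have hK0 : 0 < K := by rw [hK]; positivity
  obtain ⟨q, hq⟩ : ∃ q, q = min (1/2) (m / 4) := ⟨_, rfl⟩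
  have hq0 : 0 < q := by rw [hq]; positivity
  refine ⟨min σ (σ * Real.sqrt (q / K)), by positivity, ?_⟩
  intro S hS hd0
  have hdσ : S.d t₀ < σ := hd0.trans_le (min_le_left _ _)
  have hdn : ∀ t, 0 ≤ S.d t := fun t => Real.sqrt_nonneg _
  have hdK : K * S.d t₀ ^ 2 < q * σ ^ 2 := by
    have h1 : S.d t₀ ^ 2 < (σ * Real.sqrt (q / K)) ^ 2 :=
      pow_lt_pow_left₀ (hd0.trans_le (min_le_right _ _)) (hdn _) two_ne_zero
    rw [mul_pow, Real.sq_sqrt (by positivity)] at h1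
    have h2 := mul_lt_mul_of_pos_left h1 hK0
    have h3 : K * (σ ^ 2 * (q / K)) = q * σ ^ 2 := by field_simp
    linarith
  have hdc := StabAux.d_cont S hεc
  by_contra hcon
  push Not at hcon
  obtain ⟨t₂, ht₂, hdt₂⟩ := hcon
  -- first time at which `d` reaches `σ`
  obtain ⟨t₁, ht₁, hd1, hlt⟩ : ∃ t₁, t₀ ≤ t₁ ∧ σ ≤ S.d t₁ ∧ ∀ t, t₀ ≤ t → t < t₁ → S.d t < σ := by
    have hcl : IsClosed {t | t ∈ Ici t₀ ∧ S.d t ∈ Ici σ} :=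
      hdc.preimage_isClosed_of_isClosed isClosed_Ici isClosed_Ici
    have hne : {t | t ∈ Ici t₀ ∧ S.d t ∈ Ici σ}.Nonempty := ⟨t₂, ht₂, hdt₂⟩
    have hbd : BddBelow {t | t ∈ Ici t₀ ∧ S.d t ∈ Ici σ} := ⟨t₀, fun t ht => ht.1⟩
    have hmem := hcl.csInf_mem hne hbd
    refine ⟨_, hmem.1, hmem.2, fun t ht hlt => ?_⟩
    by_contra h
    exact absurd (csInf_le hbd ⟨ht, not_lt.1 h⟩) (not_le.2 hlt)
  have ht01 : t₀ < t₁ := by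
    rcases ht₁.lt_or_eq with h | h
    · exact h
    · rw [← h] at hd1; linarith
  have hd1' : S.d t₁ = σ := by
    apply le_antisymm _ hd1
    have hcw : ContinuousWithinAt S.d (Ico t₀ t₁) t₁ :=
      (hdc t₁ ht₁).mono Ico_subset_Ici_self
    have : (nhdsWithin t₁ (Ico t₀ t₁)).NeBot := by
      rw [← mem_closure_iff_nhdsWithin_neBot, closure_Ico ht01.ne]
      exact right_mem_Icc.2 ht₁
    refine le_of_tendsto hcw ?_
    filter_upwards [self_mem_nhdsWithin] with t ht
    exact (hlt t ht.1 ht.2).le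
  have hdle : ∀ t, t₀ ≤ t → t ≤ t₁ → S.d t ≤ σ := by
    intro t h1 h2
    rcases h2.lt_or_eq with h | h
    · exact (hlt t h1 h).le
    · rw [h, hd1']
  have husm : ∀ t, t₀ ≤ t → t ≤ t₁ → ∀ x ∈ Icc (0:ℝ) π, |S.u x t| < ρ := fun t h1 h2 x hx =>
    StabAux.u_small S h1 hx hρ ((hdle t h1 h2).trans hσρ)
  have hPc : Continuous (StabAux.Phi F) :=
    continuous_iff_continuousAt.2 fun z => (StabAux.Phi_deriv hFc z).continuousAt
  have hup : ∫ x in (0:ℝ)..π, StabAux.G S γ θ c x t₀ ≤ K * S.d t₀ ^ 2 := by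
    rw [StabAux.d_sq, hK]
    exact StabAux.upper (StabAux.slice S.cont_u le_rfl) (StabAux.slice S.cont_ut le_rfl)
      (StabAux.slice S.cont_uxx le_rfl)
      (hPc.comp_continuousOn (StabAux.slice S.cont_u le_rfl)) (StabAux.slice S.cont_ux le_rfl)
      (StabAux.green_sq S le_rfl) (fun x hx => hPhi' _ (husm t₀ le_rfl ht₁ x hx)) hM0 hγ1 ha' hθ
  have hlow : q * S.d t₁ ^ 2 ≤ ∫ x in (0:ℝ)..π, StabAux.G S γ θ c x t₁ := by
    rw [StabAux.d_sq, hq]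
    exact StabAux.lower (StabAux.slice S.cont_u ht₁) (StabAux.slice S.cont_ut ht₁)
      (StabAux.slice S.cont_uxx ht₁)
      (hPc.comp_continuousOn (StabAux.slice S.cont_u ht₁)) (StabAux.slice S.cont_ux ht₁)
      (StabAux.green_sq S ht₁) (StabAux.poin S ht₁)
      (fun x hx => hPhi _ (husm t₁ ht₁ le_rfl x hx)) (hcC t₁ (by linarith)) hm hm0 hγ1 hγm ha'
      hk hCk hθ
  have hGc := StabAux.G_cont S (γ := γ) (θ := θ) hFc (hcc0.mono hsub) hεc
  have hVd : ∀ t, t₀ < t → HasDerivAt (fun t => ∫ x in (0:ℝ)..π, StabAux.G S γ θ c x t)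
      (∫ x in (0:ℝ)..π, StabAux.Gt S ε' γ θ c c' x t) t := fun t ht =>
    StabAux.deriv_param hGc
      (StabAux.Gt_cont S hFc (hcc0.mono hsub) (hc'c0.mono hsub) hεc (hε'c0.mono hsub))
      (fun x hx s hs => StabAux.G_deriv S hFc hs hx (hcd s (ht00.trans hs))
        ((hεderiv s (ht00.trans hs).le).hasDerivAt (Ici_mem_nhds (ht00.trans hs)))) ht
  have hanti : AntitoneOn (fun t => ∫ x in (0:ℝ)..π, StabAux.G S γ θ c x t) (Icc t₀ t₁) := by
    apply antitoneOn_of_deriv_nonpos (convex_Icc _ _)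
    · exact (StabAux.cont_param hGc).mono Icc_subset_Ici_self
    · intro t ht
      rw [interior_Icc] at ht
      exact (hVd t ht.1).differentiableAt.differentiableWithinAt
    · intro t ht
      rw [interior_Icc] at ht
      rw [(hVd t ht.1).deriv]
      have htl := ht.1.le
      have ht0 : 0 < t := ht00.trans ht.1
      have hsm := husm t htl ht.2.le
      have haA : ∀ x ∈ Ioo (0:ℝ) π, S.aa x t ≤ A := by
        intro x hx
        have h1 := hS x ⟨hx.1.le, hx.2.le⟩ t htl
        have h2 : S.d t ^ τ ≤ 1 :=
          Real.rpow_le_one (hdn t) ((hdle t htl ht.2.le).trans hσ1) hτ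
        have h3 := mul_le_mul_of_nonneg_left h2 hA
        linarith
      have key := StabAux.dissip (f := fun x => F (S.u x t)) (E := ∫ x in (0:ℝ)..π, S.ux x t ^ 2)
        (StabAux.slice S.cont_u htl) (StabAux.slice S.cont_ut htl)
        (StabAux.slice S.cont_uxx htl) (StabAux.slice S.cont_uxxt htl)
        (StabAux.slice S.cont_utt htl) (hFc.comp_continuousOn (StabAux.slice S.cont_u htl))
        (fun x hx => S.pde x hx t ht.1)
        (fun x hx => S.aa_nonneg x ⟨hx.1.le, hx.2.le⟩ t htl) haA
        (StabAux.sym S ht.1) (StabAux.dissD S ht.1) (StabAux.green_sq S htl) (StabAux.poin S htl)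
        (StabAux.wf S hFderiv hF'cont hF0 hFk htl hsm)
        (fun x hx => hzF _ (hsm x ⟨hx.1.le, hx.2.le⟩))
        (c := c t) (c' := c' t) (e' := ε' t) (by rw [hc]) hμ hγA hγ0 (hεnonneg t ht0.le) hθ hk
        (hdiss t ht0.le)
        (by nlinarith [mul_le_mul_of_nonneg_left (hεge t ht0) hγ0]) (hEc t (ht₀.trans htl))
      simp only [StabAux.Gt]
      rw [intervalIntegral.integral_const_mul]
      linarith
  have hfin := hanti (left_mem_Icc.2 ht₁) (right_mem_Icc.2 ht₁) ht₁
  simp only at hfin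
  rw [hd1'] at hlow
  linarith
end

section
/- (Theorem 3.1, uniform stability) Under the standing hypotheses, if either C'(t) ≤ 0 for all t ≥ 0 or C'(t) → 0 as t → ∞, and if moreover sup_{t>0} g(t) < ∞, then the null solution is uniformly stable: there exist ξ > 0 (with ξ ≤ ρ when ρ < ∞) and κ ≥ 0 such that for every σ ∈ (0, ξ] there is δ = δ(σ) > 0, independent of t₀, such that for every t₀ ≥ κ every classical solution u on [t₀,∞) with d(t₀) < δ satisfies d(t) < σ for all t ≥ t₀. -/
open Real Set MeasureTheory Filter

lemma ii_of_cont {f : ℝ → ℝ} (h : ContinuousOn f (Icc 0 π)) : IntervalIntegrable f volume 0 π := by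
  apply ContinuousOn.intervalIntegrable
  rwa [uIcc_of_le pi_pos.le]

lemma parts_pi {u v u' v' : ℝ → ℝ}
    (hu : ∀ x ∈ Icc (0:ℝ) π, HasDerivWithinAt u (u' x) (Icc 0 π) x)
    (hv : ∀ x ∈ Icc (0:ℝ) π, HasDerivWithinAt v (v' x) (Icc 0 π) x)
    (hu' : ContinuousOn u' (Icc 0 π)) (hv' : ContinuousOn v' (Icc 0 π))
    (h0 : u 0 = 0) (h1 : u π = 0) :
    ∫ x in (0:ℝ)..π, u x * v' x = - ∫ x in (0:ℝ)..π, u' x * v x := by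
  have := intervalIntegral.integral_mul_deriv_eq_deriv_mul_of_hasDerivWithinAt (a := 0) (b := π)
    (u := u) (v := v) (u' := u') (v' := v') (by rwa [uIcc_of_le pi_pos.le])
    (by rwa [uIcc_of_le pi_pos.le]) (ii_of_cont hu') (ii_of_cont hv')
  rw [this, h0, h1]; ring

lemma poincare_aux {u u' : ℝ → ℝ}
    (hu : ∀ x ∈ Icc (0:ℝ) π, HasDerivWithinAt u (u' x) (Icc 0 π) x)
    (hu' : ContinuousOn u' (Icc 0 π)) (h0 : u 0 = 0) (h1 : u π = 0) (l : ℝ) (hl0 : 0 < l) (hl1 : l < 1) :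
    l^2 * ∫ x in (0:ℝ)..π, (u x)^2 ≤ ∫ x in (0:ℝ)..π, (u' x)^2 := by
  have hcu : ContinuousOn u (Icc 0 π) := fun x hx => (hu x hx).continuousWithinAt
  have hcos : ∀ x ∈ Icc (0:ℝ) π, cos (l * (x - π/2)) ≠ 0 := by
    intro x hx
    apply ne_of_gt
    apply cos_pos_of_mem_Ioo
    have := pi_pos
    constructor <;> nlinarith [hx.1, hx.2]
  set φ : ℝ → ℝ := fun x => l * tan (l * (x - π/2)) with hφ
  have hφd : ∀ x ∈ Icc (0:ℝ) π, HasDerivAt φ (l^2 + φ x ^2) x := by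
    intro x hx
    have h := (Real.hasDerivAt_tan (hcos x hx))
    have h2 : HasDerivAt (fun x => l * (x - π/2)) l x := by
      simpa using ((hasDerivAt_id x).sub_const (π/2)).const_mul l
    have h3 := (h.comp x h2).const_mul l
    have e : l^2 + φ x ^2 = l * (1 / cos (l * (x - π/2))^2 * l) := by
      simp only [hφ, tan_eq_sin_div_cos]
      have hc := hcos x hx
      have hs := sin_sq_add_cos_sq (l * (x - π/2))
      generalize cos (l * (x - π/2)) = c at *
      generalize sin (l * (x - π/2)) = s at *
      field_simp
      linarith
    rw [e]; exact h3
  have hφc : ContinuousOn φ (Icc 0 π) := fun x hx => (hφd x hx).continuousAt.continuousWithinAt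
  have hd : ∀ x ∈ Icc (0:ℝ) π, HasDerivWithinAt (fun x => u x ^2 * φ x)
      (2 * u x * u' x * φ x + u x ^2 * (l^2 + φ x^2)) (Icc 0 π) x := by
    intro x hx
    have := ((hu x hx).pow 2).mul (hφd x hx).hasDerivWithinAt
    refine this.congr_deriv ?_
    simp
  have hI : ∫ x in (0:ℝ)..π, (2 * u x * u' x * φ x + u x ^2 * (l^2 + φ x^2)) = 0 := by
    rw [intervalIntegral.integral_eq_sub_of_hasDerivAt_of_le pi_pos.le
      (f := fun x => u x ^2 * φ x) (by fun_prop)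
      (fun x hx => (hd x (Ioo_subset_Icc_self hx)).hasDerivAt (Icc_mem_nhds hx.1 hx.2))
      (ii_of_cont (by fun_prop))]
    simp [h0, h1]
  have hpos : 0 ≤ ∫ x in (0:ℝ)..π, (u' x + u x * φ x)^2 :=
    intervalIntegral.integral_nonneg pi_pos.le (fun x _ => sq_nonneg _)
  have e : ∫ x in (0:ℝ)..π, (u' x + u x * φ x)^2 =
      (∫ x in (0:ℝ)..π, (u' x)^2) + (∫ x in (0:ℝ)..π, (2 * u x * u' x * φ x + u x ^2 * (l^2 + φ x^2)))
       - l^2 * ∫ x in (0:ℝ)..π, (u x)^2 := by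
    rw [← intervalIntegral.integral_const_mul, ← intervalIntegral.integral_add, ← intervalIntegral.integral_sub]
    · congr 1; ext x; ring
    all_goals exact ii_of_cont (by fun_prop)
  linarith

lemma poincare {u u' : ℝ → ℝ}
    (hu : ∀ x ∈ Icc (0:ℝ) π, HasDerivWithinAt u (u' x) (Icc 0 π) x)
    (hu' : ContinuousOn u' (Icc 0 π)) (h0 : u 0 = 0) (h1 : u π = 0) :
    ∫ x in (0:ℝ)..π, (u x)^2 ≤ ∫ x in (0:ℝ)..π, (u' x)^2 := by
  have ht : Tendsto (fun l : ℝ => l^2 * ∫ x in (0:ℝ)..π, (u x)^2) (nhdsWithin 1 (Iio 1))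
      (nhds (1^2 * ∫ x in (0:ℝ)..π, (u x)^2)) := by
    apply Tendsto.mono_left _ nhdsWithin_le_nhds
    exact Continuous.tendsto (by fun_prop) 1
  rw [one_pow, one_mul] at ht
  apply le_of_tendsto ht
  filter_upwards [Ioo_mem_nhdsLT (show (0:ℝ) < 1 by norm_num)] with l hl
  exact poincare_aux hu hu' h0 h1 l hl.1 hl.2

lemma sup_bound {u u' : ℝ → ℝ}
    (hu : ∀ x ∈ Icc (0:ℝ) π, HasDerivWithinAt u (u' x) (Icc 0 π) x)
    (hu' : ContinuousOn u' (Icc 0 π)) (h0 : u 0 = 0) (y : ℝ) (hy : y ∈ Icc 0 π) :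
    u y ^2 ≤ (∫ x in (0:ℝ)..π, (u x)^2) + ∫ x in (0:ℝ)..π, (u' x)^2 := by
  have hcu : ContinuousOn u (Icc 0 π) := fun x hx => (hu x hx).continuousWithinAt
  have hsub : Icc 0 y ⊆ Icc 0 π := Icc_subset_Icc_right hy.2
  have hii : ∀ f : ℝ → ℝ, ContinuousOn f (Icc 0 π) → IntervalIntegrable f volume 0 y := by
    intro f hf
    apply ContinuousOn.intervalIntegrable
    rw [uIcc_of_le hy.1]; exact hf.mono hsub
  have hI : ∫ x in (0:ℝ)..y, (2 * u x * u' x) = u y ^2 := by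
    rw [intervalIntegral.integral_eq_sub_of_hasDerivAt_of_le hy.1
      (f := fun x => u x ^2) ((hcu.mono hsub).pow 2)
      (fun x hx => by
        have hx' : x ∈ Ioo 0 π := ⟨hx.1, hx.2.trans_le hy.2⟩
        have := ((hu x (Ioo_subset_Icc_self hx')).hasDerivAt (Icc_mem_nhds hx'.1 hx'.2)).pow 2
        refine this.congr_deriv ?_
        simp)
      (hii _ (by fun_prop))]
    simp [h0]
  rw [← hI, ← intervalIntegral.integral_add (ii_of_cont (by fun_prop)) (ii_of_cont (by fun_prop))]
  calc ∫ x in (0:ℝ)..y, (2 * u x * u' x) ≤ ∫ x in (0:ℝ)..y, (u x ^2 + u' x^2) := by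
        apply intervalIntegral.integral_mono_on hy.1 (hii _ (by fun_prop)) (hii _ (by fun_prop))
        intro x _
        nlinarith [sq_nonneg (u x - u' x)]
    _ ≤ _ := by
        apply intervalIntegral.integral_mono_interval le_rfl hy.1 hy.2
        · exact ae_of_all _ (fun x => by positivity)
        · exact ii_of_cont (by fun_prop)

lemma param_cont {f : ℝ → ℝ → ℝ} {t₀ : ℝ}
    (hf : ContinuousOn (Function.uncurry f) (Icc 0 π ×ˢ Ici t₀)) :
    ContinuousOn (fun t => ∫ x in (0:ℝ)..π, f x t) (Ici t₀) := by
  have hc : Continuous (Function.uncurry (fun t x => f (projIcc 0 π pi_pos.le x) (max t t₀))) := by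
    have : Continuous (fun p : ℝ × ℝ => ((projIcc 0 π pi_pos.le p.2 : ℝ), max p.1 t₀)) := by
      have := continuous_projIcc (a := (0:ℝ)) (h := pi_pos.le)
      fun_prop
    have h2 := hf.comp_continuous this (fun p => ⟨(projIcc 0 π pi_pos.le p.2).2, mem_Ici.2 (le_max_right _ _)⟩)
    exact h2
  have := intervalIntegral.continuous_parametric_intervalIntegral_of_continuous' (μ := volume) hc 0 π
  apply this.continuousOn.congr
  intro t ht
  apply intervalIntegral.integral_congr
  intro x hx
  rw [uIcc_of_le pi_pos.le] at hx
  simp only [max_eq_left (mem_Ici.1 ht), projIcc_of_mem pi_pos.le hx]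

lemma slice_cont {f : ℝ → ℝ → ℝ} {t₀ : ℝ}
    (hf : ContinuousOn (Function.uncurry f) (Icc 0 π ×ˢ Ici t₀)) {t : ℝ} (ht : t ∈ Ici t₀) :
    ContinuousOn (fun x => f x t) (Icc 0 π) := by
  have h : ContinuousOn (fun x : ℝ => (x, t)) (Icc 0 π) := by fun_prop
  exact hf.comp h (fun x hx => ⟨hx, ht⟩)

lemma loc_bound {f : ℝ → ℝ → ℝ} {t₀ : ℝ}
    (hf : ContinuousOn (Function.uncurry f) (Icc 0 π ×ˢ Ici t₀)) (t : ℝ) :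
    ∃ M, 0 ≤ M ∧ ∀ x ∈ Icc (0:ℝ) π, ∀ s ∈ Icc t₀ t, |f x s| ≤ M := by
  have hK : IsCompact (Icc (0:ℝ) π ×ˢ Icc t₀ t) := isCompact_Icc.prod isCompact_Icc
  obtain ⟨M, hM⟩ := hK.exists_bound_of_continuousOn
    (hf.mono (prod_mono_right Icc_subset_Ici_self))
  refine ⟨max M 0, le_max_right _ _, fun x hx s hs => ?_⟩
  exact (hM (x, s) ⟨hx, hs⟩).trans (le_max_left _ _)

lemma param_deriv {f f' : ℝ → ℝ → ℝ} {t₀ : ℝ}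
    (hf : ContinuousOn (Function.uncurry f) (Icc 0 π ×ˢ Ici t₀))
    (hf' : ContinuousOn (Function.uncurry f') (Icc 0 π ×ˢ Ici t₀))
    (hd : ∀ x ∈ Icc (0:ℝ) π, ∀ t ∈ Ici t₀,
      HasDerivWithinAt (fun s => f x s) (f' x t) (Ici t₀) t) {t : ℝ} (ht : t₀ < t) :
    HasDerivAt (fun t => ∫ x in (0:ℝ)..π, f x t) (∫ x in (0:ℝ)..π, f' x t) t := by
  obtain ⟨M, hM0, hM⟩ := loc_bound hf' (t + 1)
  have hIoc : uIoc (0:ℝ) π ⊆ Icc 0 π := by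
    rw [uIoc_of_le pi_pos.le]; exact Ioc_subset_Icc_self
  have hm : ∀ g : ℝ → ℝ, ContinuousOn g (Icc 0 π) →
      AEStronglyMeasurable g (volume.restrict (uIoc (0:ℝ) π)) := fun g hg =>
    (hg.mono hIoc).aestronglyMeasurable measurableSet_uIoc
  refine (intervalIntegral.hasDerivAt_integral_of_dominated_loc_of_deriv_le (𝕜 := ℝ)
    (F := fun t x => f x t) (F' := fun t x => f' x t) (bound := fun _ => M)
    (s := Ioo t₀ (t+1)) (Ioo_mem_nhds ht (by linarith)) ?_ ?_ ?_ ?_ ?_ ?_).2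
  · filter_upwards [Ioi_mem_nhds ht] with s hs
    exact hm _ (slice_cont hf (mem_Ici.2 (le_of_lt hs)))
  · exact ii_of_cont (slice_cont hf ht.le)
  · exact hm _ (slice_cont hf' ht.le)
  · exact ae_of_all _ (fun x hx s hs => hM x (hIoc hx) s ⟨hs.1.le, hs.2.le⟩)
  · exact intervalIntegrable_const
  · exact ae_of_all _ (fun x hx s hs => (hd x (hIoc hx) s hs.1.le).hasDerivAt (Ici_mem_nhds hs.1))

lemma param_deriv_mul {f f' g g' : ℝ → ℝ → ℝ} {t₀ : ℝ}
    (hf : ContinuousOn (Function.uncurry f) (Icc 0 π ×ˢ Ici t₀))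
    (hf' : ContinuousOn (Function.uncurry f') (Icc 0 π ×ˢ Ici t₀))
    (hd : ∀ x ∈ Icc (0:ℝ) π, ∀ t ∈ Ici t₀,
      HasDerivWithinAt (fun s => f x s) (f' x t) (Ici t₀) t)
    (hg : ContinuousOn (Function.uncurry g) (Icc 0 π ×ˢ Ici t₀))
    (hg' : ContinuousOn (Function.uncurry g') (Icc 0 π ×ˢ Ici t₀))
    (hgd : ∀ x ∈ Icc (0:ℝ) π, ∀ t ∈ Ici t₀,
      HasDerivWithinAt (fun s => g x s) (g' x t) (Ici t₀) t) {t : ℝ} (ht : t₀ < t) :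
    HasDerivAt (fun t => ∫ x in (0:ℝ)..π, f x t * g x t)
      ((∫ x in (0:ℝ)..π, f' x t * g x t) + ∫ x in (0:ℝ)..π, f x t * g' x t) t := by
  have h := param_deriv (f := fun x t => f x t * g x t)
    (f' := fun x t => f' x t * g x t + f x t * g' x t) (hf.mul hg) ((hf'.mul hg).add (hf.mul hg'))
    (fun x hx t ht => (hd x hx t ht).mul (hgd x hx t ht)) ht
  rw [intervalIntegral.integral_add] at h
  · exact h
  · exact ii_of_cont (slice_cont (f := fun x t => f' x t * g x t) (hf'.mul hg) ht.le)
  · exact ii_of_cont (slice_cont (f := fun x t => f x t * g' x t) (hf.mul hg') ht.le)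

lemma slope_bd {f f' : ℝ → ℝ → ℝ} {t₀ : ℝ}
    (hf' : ContinuousOn (Function.uncurry f') (Icc 0 π ×ˢ Ici t₀))
    (hd : ∀ x ∈ Icc (0:ℝ) π, ∀ t ∈ Ici t₀,
      HasDerivWithinAt (fun s => f x s) (f' x t) (Ici t₀) t) {t : ℝ} (ht : t₀ < t) :
    ∃ M, 0 ≤ M ∧ ∀ x ∈ Icc (0:ℝ) π, ∀ s ∈ Ioo t (t+1), |(s - t)⁻¹ * (f x s - f x t)| ≤ M := by
  obtain ⟨M, hM0, hM⟩ := loc_bound hf' (t + 1)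
  refine ⟨M, hM0, fun x hx s hs => ?_⟩
  have := Convex.norm_image_sub_le_of_norm_hasDerivWithin_le (f := fun s => f x s)
    (f' := fun s => f' x s) (s := Icc t₀ (t+1)) (C := M) (x := t) (y := s)
    (fun y hy => (hd x hx y hy.1).mono Icc_subset_Ici_self)
    (fun y hy => hM x hx y hy) (convex_Icc _ _) ⟨ht.le, by linarith⟩
    ⟨by linarith [hs.1], hs.2.le⟩
  have hst : 0 < s - t := by linarith [hs.1]
  simp only [Real.norm_eq_abs] at this
  rw [abs_of_pos hst] at this
  rw [abs_mul, abs_inv, abs_of_pos hst, inv_mul_le_iff₀ hst]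
  linarith

lemma slope_lim {f f' g g' : ℝ → ℝ → ℝ} {t₀ : ℝ}
    (hf : ContinuousOn (Function.uncurry f) (Icc 0 π ×ˢ Ici t₀))
    (hf' : ContinuousOn (Function.uncurry f') (Icc 0 π ×ˢ Ici t₀))
    (hd : ∀ x ∈ Icc (0:ℝ) π, ∀ t ∈ Ici t₀,
      HasDerivWithinAt (fun s => f x s) (f' x t) (Ici t₀) t)
    (hg : ContinuousOn (Function.uncurry g) (Icc 0 π ×ˢ Ici t₀))
    (hg' : ContinuousOn (Function.uncurry g') (Icc 0 π ×ˢ Ici t₀))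
    (hgd : ∀ x ∈ Icc (0:ℝ) π, ∀ t ∈ Ici t₀,
      HasDerivWithinAt (fun s => g x s) (g' x t) (Ici t₀) t) {t : ℝ} (ht : t₀ < t) :
    Tendsto (fun s => ∫ x in (0:ℝ)..π,
      ((s - t)⁻¹ * (f x s - f x t)) * ((s - t)⁻¹ * (g x s - g x t)))
      (nhdsWithin t (Ioi t)) (nhds (∫ x in (0:ℝ)..π, f' x t * g' x t)) := by
  obtain ⟨M, hM0, hM⟩ := slope_bd hf' hd ht
  obtain ⟨N, hN0, hN⟩ := slope_bd hg' hgd ht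
  have hIoc : uIoc (0:ℝ) π ⊆ Icc 0 π := by
    rw [uIoc_of_le pi_pos.le]; exact Ioc_subset_Icc_self
  have hm : ∀ g : ℝ → ℝ, ContinuousOn g (Icc 0 π) →
      AEStronglyMeasurable g (volume.restrict (uIoc (0:ℝ) π)) := fun g hg =>
    (hg.mono hIoc).aestronglyMeasurable measurableSet_uIoc
  apply intervalIntegral.tendsto_integral_filter_of_dominated_convergence (fun _ => M * N)
  · filter_upwards [self_mem_nhdsWithin] with s hs
    have hs' : s ∈ Ici t₀ := (ht.trans hs).le
    have h1 := slice_cont hf hs'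
    have h2 := slice_cont hf ht.le
    have h3 := slice_cont hg hs'
    have h4 := slice_cont hg ht.le
    exact hm _ (by fun_prop)
  · filter_upwards [Ioo_mem_nhdsGT (show t < t + 1 by linarith)] with s hs
    refine ae_of_all _ (fun x hx => ?_)
    rw [norm_mul]
    exact mul_le_mul (hM x (hIoc hx) s hs) (hN x (hIoc hx) s hs) (norm_nonneg _) hM0
  · exact intervalIntegrable_const
  · refine ae_of_all _ (fun x hx => ?_)
    have key : ∀ (h : ℝ → ℝ) (h' : ℝ), HasDerivWithinAt h h' (Ici t₀) t →
        Tendsto (fun s => (s - t)⁻¹ * (h s - h t)) (nhdsWithin t (Ioi t)) (nhds h') := by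
      intro h h' hh
      have h1 := (hh.hasDerivAt (Ici_mem_nhds ht)).hasDerivWithinAt (s := Ioi t)
      rw [hasDerivWithinAt_iff_tendsto_slope' (by simp)] at h1
      exact h1
    exact (key _ _ (hd x (hIoc hx) t ht.le)).mul (key _ _ (hgd x (hIoc hx) t ht.le))

namespace ClassicalSolution
variable {ε C F : ℝ → ℝ} {a' t₀ : ℝ} (S : ClassicalSolution ε C F a' t₀)

lemma u_uxx {s t : ℝ} (hs : s ∈ Ici t₀) (ht : t ∈ Ici t₀) :
    ∫ x in (0:ℝ)..π, S.u x s * S.uxx x t = - ∫ x in (0:ℝ)..π, S.ux x s * S.ux x t :=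
  parts_pi (S.hux s hs) (S.huxx t ht) (slice_cont S.cont_ux hs) (slice_cont S.cont_uxx ht)
    (S.bc0 s hs) (S.bcπ s hs)

lemma u_uxx_symm {s t : ℝ} (hs : s ∈ Ici t₀) (ht : t ∈ Ici t₀) :
    ∫ x in (0:ℝ)..π, S.u x s * S.uxx x t = ∫ x in (0:ℝ)..π, S.u x t * S.uxx x s := by
  rw [S.u_uxx hs ht, S.u_uxx ht hs]
  simp only [mul_comm]

lemma const_slice {f : ℝ → ℝ → ℝ} 
    (hf : ContinuousOn (Function.uncurry f) (Icc 0 π ×ˢ Ici t₀)) {t : ℝ} (ht : t ∈ Ici t₀) :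
    ContinuousOn (Function.uncurry (fun x (_:ℝ) => f x t)) (Icc 0 π ×ˢ Ici t₀) := by
  have h : ContinuousOn (fun p : ℝ × ℝ => (p.1, t)) (Icc 0 π ×ˢ Ici t₀) := by fun_prop
  exact hf.comp h (fun p hp => ⟨hp.1, ht⟩)

lemma u_uxxt {t : ℝ} (ht : t₀ < t) :
    ∫ x in (0:ℝ)..π, S.u x t * S.uxxt x t = ∫ x in (0:ℝ)..π, S.ut x t * S.uxx x t := by
  have hz : ContinuousOn (Function.uncurry (fun (_:ℝ) (_:ℝ) => (0:ℝ))) (Icc 0 π ×ˢ Ici t₀) :=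
    continuousOn_const
  have h1 := param_deriv_mul (const_slice S.cont_u ht.le) hz
    (fun x _ t _ => hasDerivWithinAt_const _ _ _) S.cont_uxx S.cont_uxxt S.huxxt ht
  have h2 := param_deriv_mul S.cont_u S.cont_ut S.hut (const_slice S.cont_uxx ht.le) hz
    (fun x _ t _ => hasDerivWithinAt_const _ _ _) ht
  have he : (fun s => ∫ x in (0:ℝ)..π, S.u x t * S.uxx x s) =ᶠ[nhds t]
      (fun s => ∫ x in (0:ℝ)..π, S.u x s * S.uxx x t) := by
    filter_upwards [Ioi_mem_nhds ht] with s hs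
    exact S.u_uxx_symm ht.le (mem_Ici.2 (le_of_lt hs))
  have h3 := h1.unique (h2.congr_of_eventuallyEq he)
  simpa using h3

lemma deriv_X {t : ℝ} (ht : t₀ < t) :
    HasDerivAt (fun t => ∫ x in (0:ℝ)..π, S.ux x t * S.ux x t)
      (-2 * ∫ x in (0:ℝ)..π, S.ut x t * S.uxx x t) t := by
  have h := (param_deriv_mul S.cont_u S.cont_ut S.hut S.cont_uxx S.cont_uxxt S.huxxt ht).neg
  rw [S.u_uxxt ht] at h
  have he : (fun s => ∫ x in (0:ℝ)..π, S.ux x s * S.ux x s) =ᶠ[nhds t]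
      (-fun s => ∫ x in (0:ℝ)..π, S.u x s * S.uxx x s) := by
    filter_upwards [Ioi_mem_nhds ht] with s hs
    have := S.u_uxx (s := s) (t := s) (mem_Ici.2 (le_of_lt hs)) (mem_Ici.2 (le_of_lt hs))
    simp only [Pi.neg_apply]
    linarith
  refine (h.congr_of_eventuallyEq he).congr_deriv (by ring)

lemma ut_uxxt {t : ℝ} (ht : t₀ < t) :
    ∫ x in (0:ℝ)..π, S.ut x t * S.ut x t ≤ - ∫ x in (0:ℝ)..π, S.ut x t * S.uxxt x t := by
  have h1 := slope_lim S.cont_u S.cont_ut S.hut S.cont_u S.cont_ut S.hut ht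
  have h2 := (slope_lim S.cont_u S.cont_ut S.hut S.cont_uxx S.cont_uxxt S.huxxt ht).neg
  refine le_of_tendsto_of_tendsto h1 h2 ?_
  filter_upwards [self_mem_nhdsWithin] with s hs
  have hs' : s ∈ Ici t₀ := (ht.trans hs).le
  have ht' : t ∈ Ici t₀ := ht.le
  have d1 : ∀ x ∈ Icc (0:ℝ) π, HasDerivWithinAt (fun x => (s - t)⁻¹ * (S.u x s - S.u x t))
      ((s - t)⁻¹ * (S.ux x s - S.ux x t)) (Icc 0 π) x := fun x hx =>
    ((S.hux s hs' x hx).sub (S.hux t ht' x hx)).const_mul _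
  have d2 : ∀ x ∈ Icc (0:ℝ) π, HasDerivWithinAt (fun x => (s - t)⁻¹ * (S.ux x s - S.ux x t))
      ((s - t)⁻¹ * (S.uxx x s - S.uxx x t)) (Icc 0 π) x := fun x hx =>
    ((S.huxx s hs' x hx).sub (S.huxx t ht' x hx)).const_mul _
  have c1 : ContinuousOn (fun x => (s - t)⁻¹ * (S.ux x s - S.ux x t)) (Icc 0 π) := 
    fun x hx => (d2 x hx).continuousWithinAt
  have c2 : ContinuousOn (fun x => (s - t)⁻¹ * (S.uxx x s - S.uxx x t)) (Icc 0 π) := by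
    have := slice_cont S.cont_uxx hs'
    have := slice_cont S.cont_uxx ht'
    fun_prop
  have b0 : (s - t)⁻¹ * (S.u 0 s - S.u 0 t) = 0 := by rw [S.bc0 s hs', S.bc0 t ht']; simp
  have b1 : (s - t)⁻¹ * (S.u π s - S.u π t) = 0 := by rw [S.bcπ s hs', S.bcπ t ht']; simp
  have p1 := poincare d1 c1 b0 b1
  have p2 := parts_pi d1 d2 c1 c2 b0 b1
  rw [p2, neg_neg]
  simpa only [pow_two] using p1

lemma u_le_ux {t : ℝ} (ht : t ∈ Ici t₀) :
    ∫ x in (0:ℝ)..π, S.u x t * S.u x t ≤ ∫ x in (0:ℝ)..π, S.ux x t * S.ux x t := by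
  have := poincare (S.hux t ht) (slice_cont S.cont_ux ht) (S.bc0 t ht) (S.bcπ t ht)
  simpa only [pow_two] using this

lemma F_uxx {F' : ℝ → ℝ} (hF : ∀ z, HasDerivAt F (F' z) z) (hF' : Continuous F') (hF0 : F 0 = 0)
    {t : ℝ} (ht : t ∈ Ici t₀) :
    ∫ x in (0:ℝ)..π, F (S.u x t) * S.uxx x t =
      - ∫ x in (0:ℝ)..π, (F' (S.u x t) * S.ux x t) * S.ux x t := by
  apply parts_pi (fun x hx => (hF (S.u x t)).comp_hasDerivWithinAt x (S.hux t ht x hx))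
    (S.huxx t ht)
  · exact (hF'.comp_continuousOn (slice_cont S.cont_u ht)).mul (slice_cont S.cont_ux ht)
  · exact slice_cont S.cont_uxx ht
  · simp [S.bc0 t ht, hF0]
  · simp [S.bcπ t ht, hF0]
end ClassicalSolution

namespace ClassicalSolution
variable {ε C F : ℝ → ℝ} {a' t₀ : ℝ} (S : ClassicalSolution ε C F a' t₀)

lemma pde_int (hF : Continuous F) {g : ℝ → ℝ} (hg : ContinuousOn g (Icc 0 π)) {t : ℝ} (ht : t₀ < t) :
    ∫ x in (0:ℝ)..π, g x * S.utt x t =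
      ε t * (∫ x in (0:ℝ)..π, g x * S.uxxt x t) + C t * (∫ x in (0:ℝ)..π, g x * S.uxx x t)
      - a' * (∫ x in (0:ℝ)..π, g x * S.ut x t) + (∫ x in (0:ℝ)..π, g x * F (S.u x t))
      - ∫ x in (0:ℝ)..π, S.aa x t * (g x * S.ut x t) := by
  have ht' : t ∈ Ici t₀ := ht.le
  have c1 := slice_cont S.cont_u ht'
  have c2 := slice_cont S.cont_uxx ht'
  have c3 := slice_cont S.cont_ut ht'
  have c4 := slice_cont S.cont_uxxt ht'
  have c5 := slice_cont S.cont_aa ht'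
  have c6 : ContinuousOn (fun x => F (S.u x t)) (Icc 0 π) := hF.comp_continuousOn c1
  rw [← intervalIntegral.integral_const_mul, ← intervalIntegral.integral_const_mul,
    ← intervalIntegral.integral_const_mul, ← intervalIntegral.integral_add,
    ← intervalIntegral.integral_sub, ← intervalIntegral.integral_add,
    ← intervalIntegral.integral_sub]
  · apply intervalIntegral.integral_congr_ae
    have hne : ∀ᵐ x : ℝ, x ≠ π := by
      rw [ae_iff]; simp
    filter_upwards [hne] with x hx hx2
    rw [uIoc_of_le pi_pos.le] at hx2
    have := S.pde x ⟨hx2.1, lt_of_le_of_ne hx2.2 hx⟩ t ht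
    have e : S.utt x t = ε t * S.uxxt x t + C t * S.uxx x t - a' * S.ut x t + F (S.u x t)
      - S.aa x t * S.ut x t := by linarith
    rw [e]; ring
  all_goals exact ii_of_cont (by fun_prop)

/-- Lyapunov functional. -/
noncomputable def lyap (ε' Φ : ℝ → ℝ) (γ θ : ℝ) (t : ℝ) : ℝ :=
  γ * (1/2 * (∫ x in (0:ℝ)..π, S.ut x t * S.ut x t)
      + C t / 2 * (∫ x in (0:ℝ)..π, S.ux x t * S.ux x t) - ∫ x in (0:ℝ)..π, Φ (S.u x t))
  + 1/2 * (ε t ^2 * (∫ x in (0:ℝ)..π, S.uxx x t * S.uxx x t)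
      - 2 * ε t * (∫ x in (0:ℝ)..π, S.ut x t * S.uxx x t)
      + ∫ x in (0:ℝ)..π, S.ut x t * S.ut x t)
  + (C t - ε' t + ε t * a') / 2 * (∫ x in (0:ℝ)..π, S.ux x t * S.ux x t)
  - (∫ x in (0:ℝ)..π, Φ (S.u x t))
  + θ * ((∫ x in (0:ℝ)..π, S.u x t * S.ut x t)
      + ε t / 2 * (∫ x in (0:ℝ)..π, S.ux x t * S.ux x t)
      + a' / 2 * (∫ x in (0:ℝ)..π, S.u x t * S.u x t))

lemma lyap_cont (ht₀ : 0 ≤ t₀) {ε' Φ : ℝ → ℝ} (γ θ : ℝ) (hε : ContinuousOn ε (Ici 0))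
    (hε' : ContinuousOn ε' (Ici 0)) (hC : ContinuousOn C (Ici 0)) (hΦ : Continuous Φ) :
    ContinuousOn (S.lyap ε' Φ γ θ) (Ici t₀) := by
  have hs : Ici t₀ ⊆ Ici 0 := Ici_subset_Ici.2 ht₀
  have e1 := hε.mono hs
  have e2 := hε'.mono hs
  have e3 := hC.mono hs
  have i1 := param_cont (f := fun x t => S.ut x t * S.ut x t) (S.cont_ut.mul S.cont_ut)
  have i2 := param_cont (f := fun x t => S.ux x t * S.ux x t) (S.cont_ux.mul S.cont_ux)
  have i3 := param_cont (f := fun x t => S.uxx x t * S.uxx x t) (S.cont_uxx.mul S.cont_uxx)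
  have i4 := param_cont (f := fun x t => S.ut x t * S.uxx x t) (S.cont_ut.mul S.cont_uxx)
  have i5 := param_cont (f := fun x t => S.u x t * S.ut x t) (S.cont_u.mul S.cont_ut)
  have i6 := param_cont (f := fun x t => S.u x t * S.u x t) (S.cont_u.mul S.cont_u)
  have i7 := param_cont (f := fun x t => Φ (S.u x t)) (hΦ.comp_continuousOn S.cont_u)
  unfold lyap
  fun_prop

lemma lyap_deriv {ε' ε'' C' Φ : ℝ → ℝ} (γ θ : ℝ) {t : ℝ} (ht : t₀ < t)
    (hε : HasDerivAt ε (ε' t) t) (hε' : HasDerivAt ε' (ε'' t) t) (hC : HasDerivAt C (C' t) t)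
    (hF : Continuous F) (hΦ : ∀ z, HasDerivAt Φ (F z) z) :
    HasDerivAt (S.lyap ε' Φ γ θ)
    (γ * (C' t / 2 * (∫ x in (0:ℝ)..π, S.ux x t * S.ux x t)
        + ε t * (∫ x in (0:ℝ)..π, S.ut x t * S.uxxt x t)
        - a' * (∫ x in (0:ℝ)..π, S.ut x t * S.ut x t)
        - ∫ x in (0:ℝ)..π, S.aa x t * (S.ut x t * S.ut x t))
      + (- ε t * (C t - ε' t) * (∫ x in (0:ℝ)..π, S.uxx x t * S.uxx x t)
        + (C' t - ε'' t + ε' t * a') / 2 * (∫ x in (0:ℝ)..π, S.ux x t * S.ux x t)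
        + ε t * (∫ x in (0:ℝ)..π, S.aa x t * (S.uxx x t * S.ut x t))
        - a' * (∫ x in (0:ℝ)..π, S.ut x t * S.ut x t)
        - (∫ x in (0:ℝ)..π, S.aa x t * (S.ut x t * S.ut x t))
        - ε t * (∫ x in (0:ℝ)..π, S.uxx x t * F (S.u x t)))
      + θ * ((∫ x in (0:ℝ)..π, S.ut x t * S.ut x t)
        - (C t - ε' t / 2) * (∫ x in (0:ℝ)..π, S.ux x t * S.ux x t)
        - (∫ x in (0:ℝ)..π, S.aa x t * (S.u x t * S.ut x t))
        + ∫ x in (0:ℝ)..π, S.u x t * F (S.u x t))) t := by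
  have ht' : t ∈ Ici t₀ := ht.le
  have c1 := slice_cont S.cont_u ht'
  have c2 := slice_cont S.cont_uxx ht'
  have c3 := slice_cont S.cont_ut ht'
  have i1 := param_deriv_mul S.cont_ut S.cont_utt S.hutt S.cont_ut S.cont_utt S.hutt ht
  have i2 := S.deriv_X ht
  have i3 := param_deriv_mul S.cont_uxx S.cont_uxxt S.huxxt S.cont_uxx S.cont_uxxt S.huxxt ht
  have i4 := param_deriv_mul S.cont_ut S.cont_utt S.hutt S.cont_uxx S.cont_uxxt S.huxxt ht
  have i5 := param_deriv_mul S.cont_u S.cont_ut S.hut S.cont_ut S.cont_utt S.hutt ht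
  have i6 := param_deriv_mul S.cont_u S.cont_ut S.hut S.cont_u S.cont_ut S.hut ht
  have hΦc : Continuous Φ := continuous_iff_continuousAt.2 fun z => (hΦ z).continuousAt
  have i7 := param_deriv (f := fun x t => Φ (S.u x t)) (f' := fun x t => F (S.u x t) * S.ut x t)
    (hΦc.comp_continuousOn S.cont_u) ((hF.comp_continuousOn S.cont_u).mul S.cont_ut)
    (fun x hx s hs => (hΦ (S.u x s)).comp_hasDerivWithinAt s (S.hut x hx s hs)) ht
  have j1 := S.pde_int hF c3 ht
  have j2 := S.pde_int hF c2 ht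
  have j3 := S.pde_int hF c1 ht
  have k1 := S.u_uxxt ht
  have k2 := S.u_uxx ht' ht'
  have sw : ∀ f g : ℝ → ℝ → ℝ, ∫ x in (0:ℝ)..π, f x t * g x t = ∫ x in (0:ℝ)..π, g x t * f x t := by
    intro f g; simp only [mul_comm]
  have s1 := sw S.utt S.ut
  have s2 := sw S.utt S.uxx
  have s3 := sw S.uxxt S.uxx
  have s4 := sw S.uxx S.ut
  have s5 := sw S.ut S.u
  have s6 := sw (fun x t => F (S.u x t)) S.ut
  have main := (((((((i1.const_mul (1/2)).add ((hC.div_const 2).mul i2)).sub i7).const_mul γ).add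
    (((((hε.pow 2).mul i3).sub ((hε.const_mul 2).mul i4)).add i1).const_mul (1/2))).add
    ((((hC.sub hε').add (hε.mul_const a')).div_const 2).mul i2)).sub i7).add
    (((i5.add ((hε.div_const 2).mul i2)).add (i6.const_mul (a'/2))).const_mul θ)
  refine HasDerivAt.congr_deriv (f' := _) (f := S.lyap ε' Φ γ θ) main ?_
  simp only [Pi.pow_apply, Pi.sub_apply, Pi.add_apply]
  rw [s1, s2, s3, s5, s6, j1, j2, j3, k1, k2, s4]
  push_cast
  ring

end ClassicalSolution

lemma quad_nonneg {f g : ℝ → ℝ} (hf : ContinuousOn f (Icc 0 π)) (hg : ContinuousOn g (Icc 0 π))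
    (p q : ℝ) : 0 ≤ p^2 * (∫ x in (0:ℝ)..π, f x * f x) + 2 * p * q * (∫ x in (0:ℝ)..π, f x * g x)
      + q^2 * ∫ x in (0:ℝ)..π, g x * g x := by
  have h : 0 ≤ ∫ x in (0:ℝ)..π, (p * f x + q * g x)^2 :=
    intervalIntegral.integral_nonneg pi_pos.le (fun x _ => sq_nonneg _)
  rw [← intervalIntegral.integral_const_mul, ← intervalIntegral.integral_const_mul,
    ← intervalIntegral.integral_const_mul, ← intervalIntegral.integral_add,
    ← intervalIntegral.integral_add]
  · refine h.trans_eq ?_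
    congr 1; ext x; ring
  all_goals exact ii_of_cont (by fun_prop)

lemma a_pointwise {a A μ γ θ u v e : ℝ} (ha : 0 ≤ a) (haA : a ≤ A) (hμ : 0 < μ)
    (hγ : (A+1)/(4*μ) + θ^2*(A+1)/4 ≤ γ) :
    e * (a * v) - (γ+1) * (a * (v * v)) - θ * (a * (u * v)) ≤ μ * e^2 + u^2 := by
  have h1 : a * (e * v) ≤ μ * e^2 + a^2 * v^2 / (4*μ) := by
    have : μ * e^2 - a * (e * v) + a^2 * v^2 / (4*μ) = μ * (e - a * v / (2*μ))^2 := by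
      field_simp; ring
    nlinarith [mul_nonneg hμ.le (sq_nonneg (e - a * v / (2*μ)))]
  have h2 : - θ * (a * (u * v)) ≤ u^2 + a^2 * θ^2 * v^2 / 4 := by
    nlinarith [sq_nonneg (u + a * θ * v / 2)]
  have h3 : a^2 ≤ a * (A+1) := by nlinarith
  have h4 : a^2 * (v^2/(4*μ) + θ^2*v^2/4) ≤ a * (A+1) * (v^2/(4*μ) + θ^2*v^2/4) :=
    mul_le_mul_of_nonneg_right h3 (by positivity)
  have h5 : a * v^2 * ((A+1)/(4*μ) + θ^2*(A+1)/4) ≤ a * v^2 * γ :=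
    mul_le_mul_of_nonneg_left hγ (by positivity)
  have e1 : a^2 * v^2 / (4*μ) + a^2 * θ^2 * v^2 / 4 = a^2 * (v^2/(4*μ) + θ^2*v^2/4) := by ring
  have e2 : a * (A+1) * (v^2/(4*μ) + θ^2*v^2/4) = a * v^2 * ((A+1)/(4*μ) + θ^2*(A+1)/4) := by ring
  nlinarith [mul_nonneg ha (sq_nonneg v)]

lemma scalar_D {γ θ C ε ε' ε'' C' a' k μ K c₀ m X U I1 I3 N Avv Axv Auv G H : ℝ}
    (hX : 0 ≤ X) (hI1 : 0 ≤ I1) (hI3 : 0 ≤ I3) (hU : U ≤ X) (hN : N ≤ -I1)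
    (hG : -G ≤ k * X) (hH : H ≤ k * U) (hk : 0 ≤ k) (hε : 0 ≤ ε) (hμ : 0 < μ) (ha' : 0 ≤ a')
    (hA : ε * Axv - (γ+1) * Avv - θ * Auv ≤ μ * ε^2 * I3 + U)
    (hdiss : μ * (1 + ε) ≤ C - ε') (hγ0 : 0 ≤ γ) (hθ : 0 ≤ θ)
    (hC' : (γ+1) * C' ≤ 1) (hK : (-ε'' + ε' * a')/2 + ε * k ≤ K)
    (hc : c₀ ≤ C - ε'/2 - k) (hθK : K + 2 ≤ θ * c₀) (hm : m ≤ ε + a') (hγm : θ ≤ γ * m) :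
    γ * (C' / 2 * X + ε * N - a' * I1 - Avv) + (- ε * (C - ε') * I3 + (C' - ε'' + ε' * a') / 2 * X
      + ε * Axv - a' * I1 - Avv - ε * G) + θ * (I1 - (C - ε'/2) * X - Auv + H) ≤ 0 := by
  have h1 : γ * (ε * N) ≤ γ * (ε * (-I1)) := by gcongr
  have h2 : ε * (-G) ≤ ε * (k * X) := by gcongr
  have h3 : θ * H ≤ θ * (k * X) := by
    have : k * U ≤ k * X := by gcongr
    gcongr; linarith
  have h4 : μ * ε^2 * I3 ≤ ε * (C - ε') * I3 := by
    apply mul_le_mul_of_nonneg_right _ hI3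
    nlinarith [mul_le_mul_of_nonneg_left hdiss hε, mul_nonneg hμ.le hε]
  have h5 : (γ+1) * C' / 2 * X ≤ 1/2 * X := by
    apply mul_le_mul_of_nonneg_right _ hX; linarith
  have h6 : ((-ε'' + ε' * a')/2 + ε * k) * X ≤ K * X := mul_le_mul_of_nonneg_right hK hX
  have h7 : θ * (c₀ * X) ≤ θ * ((C - ε'/2 - k) * X) := by gcongr
  have h8 : (K+2) * X ≤ θ * c₀ * X := mul_le_mul_of_nonneg_right hθK hX
  have h9 : γ * m * I1 ≤ γ * (ε + a') * I1 := by gcongr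
  have h10 : θ * I1 ≤ γ * m * I1 := by gcongr
  have h11 : 0 ≤ a' * I1 := by positivity
  nlinarith

namespace ClassicalSolution
variable {ε C F : ℝ → ℝ} {a' t₀ : ℝ} (S : ClassicalSolution ε C F a' t₀)

lemma sq_int_nonneg (f : ℝ → ℝ) : 0 ≤ ∫ x in (0:ℝ)..π, f x * f x :=
  intervalIntegral.integral_nonneg pi_pos.le (fun x _ => mul_self_nonneg _)

lemma d_sq {t : ℝ} (ht : t ∈ Ici t₀) : S.d t ^ 2 =
    ε t ^2 * (∫ x in (0:ℝ)..π, S.uxx x t * S.uxx x t) + (∫ x in (0:ℝ)..π, S.ux x t * S.ux x t)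
    + (∫ x in (0:ℝ)..π, S.u x t * S.u x t) + ∫ x in (0:ℝ)..π, S.ut x t * S.ut x t := by
  have c1 := slice_cont S.cont_u ht
  have c2 := slice_cont S.cont_uxx ht
  have c3 := slice_cont S.cont_ut ht
  have c4 := slice_cont S.cont_ux ht
  unfold d
  rw [Real.sq_sqrt (intervalIntegral.integral_nonneg pi_pos.le (fun x _ => by positivity)),
    ← intervalIntegral.integral_const_mul, ← intervalIntegral.integral_add,
    ← intervalIntegral.integral_add, ← intervalIntegral.integral_add]
  · congr 1; ext x; ring
  all_goals exact ii_of_cont (by fun_prop)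

lemma d_nonneg (t : ℝ) : 0 ≤ S.d t := Real.sqrt_nonneg _

lemma d_cont (ht₀ : 0 ≤ t₀) (hε : ContinuousOn ε (Ici 0)) : ContinuousOn S.d (Ici t₀) := by
  have e1 := hε.mono (Ici_subset_Ici.2 ht₀)
  unfold d
  apply ContinuousOn.sqrt
  apply param_cont (f := fun x t => (ε t)^2 * (S.uxx x t)^2 + (S.ux x t)^2 + (S.u x t)^2 + (S.ut x t)^2)
  have e2 : ContinuousOn (fun p : ℝ × ℝ => ε p.2) (Icc 0 π ×ˢ Ici t₀) :=
    e1.comp continuousOn_snd (fun p hp => hp.2)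
  exact ((((e2.pow 2).mul (S.cont_uxx.pow 2)).add (S.cont_ux.pow 2)).add (S.cont_u.pow 2)).add
    (S.cont_ut.pow 2)

lemma u_le_d {t : ℝ} (ht : t ∈ Ici t₀) {x : ℝ} (hx : x ∈ Icc 0 π) : |S.u x t| ≤ S.d t := by
  apply abs_le_of_sq_le_sq _ (S.d_nonneg t)
  have h := sup_bound (S.hux t ht) (slice_cont S.cont_ux ht) (S.bc0 t ht) x hx
  simp only [pow_two (S.u _ t), pow_two (S.ux _ t)] at h
  have h1 := sq_int_nonneg (fun x => S.uxx x t)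
  have h2 := sq_int_nonneg (fun x => S.ut x t)
  rw [S.d_sq ht]
  nlinarith [mul_nonneg (sq_nonneg (ε t)) h1]

lemma a_int {t A μ γ θ : ℝ} (ht : t ∈ Ici t₀) (haA : ∀ x ∈ Icc (0:ℝ) π, S.aa x t ≤ A) (hμ : 0 < μ)
    (hγ : (A+1)/(4*μ) + θ^2*(A+1)/4 ≤ γ) :
    ε t * (∫ x in (0:ℝ)..π, S.aa x t * (S.uxx x t * S.ut x t))
     - (γ+1) * (∫ x in (0:ℝ)..π, S.aa x t * (S.ut x t * S.ut x t))
     - θ * (∫ x in (0:ℝ)..π, S.aa x t * (S.u x t * S.ut x t)) ≤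
     μ * ε t^2 * (∫ x in (0:ℝ)..π, S.uxx x t * S.uxx x t) + ∫ x in (0:ℝ)..π, S.u x t * S.u x t := by
  have c1 := slice_cont S.cont_u ht
  have c2 := slice_cont S.cont_uxx ht
  have c3 := slice_cont S.cont_ut ht
  have c4 := slice_cont S.cont_aa ht
  rw [← intervalIntegral.integral_const_mul, ← intervalIntegral.integral_const_mul,
    ← intervalIntegral.integral_const_mul, ← intervalIntegral.integral_const_mul,
    ← intervalIntegral.integral_add, ← intervalIntegral.integral_sub,
    ← intervalIntegral.integral_sub]
  · apply intervalIntegral.integral_mono_on pi_pos.le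
    · exact ii_of_cont (by fun_prop)
    · exact ii_of_cont (by fun_prop)
    · intro x hx
      have := a_pointwise (u := S.u x t) (v := S.ut x t) (e := ε t * S.uxx x t)
        (S.aa_nonneg x hx t ht) (haA x hx) hμ hγ
      nlinarith
  all_goals exact ii_of_cont (by fun_prop)

lemma H_int {t k ρ : ℝ} (ht : t ∈ Ici t₀) (hF : Continuous F) (hd : S.d t < ρ)
    (hFk : ∀ z, |z| < ρ → z * F z ≤ k * (z * z)) :
    ∫ x in (0:ℝ)..π, S.u x t * F (S.u x t) ≤ k * ∫ x in (0:ℝ)..π, S.u x t * S.u x t := by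
  have c1 := slice_cont S.cont_u ht
  have c6 : ContinuousOn (fun x => F (S.u x t)) (Icc 0 π) := hF.comp_continuousOn c1
  rw [← intervalIntegral.integral_const_mul]
  apply intervalIntegral.integral_mono_on pi_pos.le
  · exact ii_of_cont (by fun_prop)
  · exact ii_of_cont (by fun_prop)
  · intro x hx
    exact hFk _ ((S.u_le_d ht hx).trans_lt hd)

lemma Phi_int {Φ : ℝ → ℝ} {t k ρ : ℝ} (ht : t ∈ Ici t₀) (hF : Continuous Φ) (hd : S.d t < ρ)
    (hFk : ∀ z, |z| < ρ → Φ z ≤ k * (z * z)) :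
    ∫ x in (0:ℝ)..π, Φ (S.u x t) ≤ k * ∫ x in (0:ℝ)..π, S.u x t * S.u x t := by
  have c1 := slice_cont S.cont_u ht
  have c6 : ContinuousOn (fun x => Φ (S.u x t)) (Icc 0 π) := hF.comp_continuousOn c1
  rw [← intervalIntegral.integral_const_mul]
  apply intervalIntegral.integral_mono_on pi_pos.le
  · exact ii_of_cont (by fun_prop)
  · exact ii_of_cont (by fun_prop)
  · intro x hx
    exact hFk _ ((S.u_le_d ht hx).trans_lt hd)

lemma G_int {F' : ℝ → ℝ} {t k ρ : ℝ} (ht : t ∈ Ici t₀) (hF : ∀ z, HasDerivAt F (F' z) z)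
    (hF' : Continuous F') (hF0 : F 0 = 0) (hd : S.d t < ρ)
    (hFk : ∀ z, |z| < ρ → F' z ≤ k) :
    -(∫ x in (0:ℝ)..π, S.uxx x t * F (S.u x t)) ≤ k * ∫ x in (0:ℝ)..π, S.ux x t * S.ux x t := by
  have c1 := slice_cont S.cont_u ht
  have c2 := slice_cont S.cont_ux ht
  have c6 : ContinuousOn (fun x => F' (S.u x t)) (Icc 0 π) := hF'.comp_continuousOn c1
  have h := S.F_uxx hF hF' hF0 ht
  simp only [mul_comm (F _)] at h
  rw [h, neg_neg, ← intervalIntegral.integral_const_mul]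
  apply intervalIntegral.integral_mono_on pi_pos.le
  · exact ii_of_cont (by fun_prop)
  · exact ii_of_cont (by fun_prop)
  · intro x hx
    have := hFk _ ((S.u_le_d ht hx).trans_lt hd)
    rw [mul_assoc]
    exact mul_le_mul_of_nonneg_right this (mul_self_nonneg _)

lemma lyap_lower {ε' Φ : ℝ → ℝ} {γ θ t k ρ μ c : ℝ} (ht : t ∈ Ici t₀) (hΦ : Continuous Φ)
    (hd : S.d t < ρ) (hΦk : ∀ z, |z| < ρ → Φ z ≤ k/2 * (z * z)) (hk : 0 ≤ k)
    (hε : 0 ≤ ε t) (ha' : 0 ≤ a') (hθ : 0 ≤ θ) (hγ1 : 1 ≤ γ) (hc : 0 < c) (hCc : c ≤ C t) (hck : k ≤ c)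
    (hdiss : μ ≤ C t - ε' t) (hmuk : 0 < μ + c/2 - 2 * k) (hγ : 4*θ^2/c + 2 ≤ γ) :
    min (1/4) (c/16) * S.d t ^2 ≤ S.lyap ε' Φ γ θ t := by
  have c1 := slice_cont S.cont_u ht
  have c2 := slice_cont S.cont_uxx ht
  have c3 := slice_cont S.cont_ut ht
  have hP := S.Phi_int ht hΦ hd hΦk
  have q1 := quad_nonneg c3 c2 1 (-(ε t)/2)
  have q2 := quad_nonneg c1 c3 1 (4*θ/c)
  have hUX := S.u_le_ux ht
  rw [S.d_sq ht]
  unfold lyap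
  have p1 := sq_int_nonneg (fun x => S.uxx x t)
  have p2 := sq_int_nonneg (fun x => S.ut x t)
  have p3 := sq_int_nonneg (fun x => S.u x t)
  have p4 := sq_int_nonneg (fun x => S.ux x t)
  generalize (∫ x in (0:ℝ)..π, S.uxx x t * S.uxx x t) = I3 at *
  generalize (∫ x in (0:ℝ)..π, S.ut x t * S.ut x t) = I1 at *
  generalize (∫ x in (0:ℝ)..π, S.u x t * S.u x t) = U at *
  generalize (∫ x in (0:ℝ)..π, S.ux x t * S.ux x t) = X at *
  generalize (∫ x in (0:ℝ)..π, S.ut x t * S.uxx x t) = I2 at *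
  generalize (∫ x in (0:ℝ)..π, S.u x t * S.ut x t) = Y at *
  generalize (∫ x in (0:ℝ)..π, Φ (S.u x t)) = P at *
  have q2' : 0 ≤ c/8 * U + θ * Y + 2*θ^2/c * I1 := by
    have := mul_nonneg (show 0 ≤ c/8 by positivity) q2
    have e : c/8 * (1^2 * U + 2 * 1 * (4*θ/c) * Y + (4*θ/c)^2 * I1) = c/8 * U + θ * Y + 2*θ^2/c * I1 := by
      field_simp; ring
    linarith
  have h1 : (γ+1) * P ≤ (γ+1) * (k/2 * X) := by
    have : k/2 * U ≤ k/2 * X := by gcongr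
    apply mul_le_mul_of_nonneg_left _ (by linarith)
    linarith
  have h2 : c/2 ≤ (γ+1) * (C t - k) - ε' t := by
    have : 1 * (C t - k) ≤ γ * (C t - k) := mul_le_mul_of_nonneg_right hγ1 (by linarith)
    nlinarith
  have h3 := mul_le_mul_of_nonneg_right h2 p4
  have h4 : (4*θ^2/c + 2) * I1 ≤ γ * I1 := mul_le_mul_of_nonneg_right hγ p2
  have e4 : (4*θ^2/c + 2) * I1 = 2 * (2*θ^2/c * I1) + 2 * I1 := by ring
  have h5 : 0 ≤ ε t * a' * X := by positivity
  have h6 : 0 ≤ θ * (ε t * X) := by positivity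
  have h7 : 0 ≤ θ * (a' * U) := by positivity
  have p5 : 0 ≤ ε t^2 * I3 := by positivity
  have m1 : min (1/4) (c/16) ≤ 1/4 := min_le_left _ _
  have m2 : min (1/4) (c/16) ≤ c/16 := min_le_right _ _
  generalize min (1/4) (c/16) = m at *
  have n1 := mul_le_mul_of_nonneg_right m1 p5
  have n2 := mul_le_mul_of_nonneg_right m2 p4
  have n3 := mul_le_mul_of_nonneg_right m2 p3
  have n4 := mul_le_mul_of_nonneg_right m1 p2
  have n5 : c * U ≤ c * X := by gcongr
  nlinarith

lemma lyap_upper {ε' Φ : ℝ → ℝ} {γ θ t M ρ CM E2 eM : ℝ} (ht : t ∈ Ici t₀) (hΦ : Continuous Φ)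
    (hd : S.d t < ρ) (hΦM : ∀ z, |z| < ρ → -Φ z ≤ M * (z * z)) (hM : 0 ≤ M)
    (hε : 0 ≤ ε t) (ha' : 0 ≤ a') (hθ : 0 ≤ θ) (hγ : 0 ≤ γ) (hC : C t ≤ CM) (hCM : 0 ≤ CM)
    (hE2 : -ε' t ≤ E2) (hE20 : 0 ≤ E2) (heM : ε t ≤ eM) :
    S.lyap ε' Φ γ θ t ≤ (γ + γ * CM + (γ+1) * M + 2 + CM + E2 + eM * a' + θ + θ * eM + θ * a') 
      * S.d t ^2 := by
  have c1 := slice_cont S.cont_u ht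
  have c2 := slice_cont S.cont_uxx ht
  have c3 := slice_cont S.cont_ut ht
  have hP := S.Phi_int ht hΦ.neg hd hΦM
  simp only [Pi.neg_apply, intervalIntegral.integral_neg] at hP
  have q1 := quad_nonneg c3 c2 1 (ε t)
  have q2 := quad_nonneg c1 c3 1 (-1)
  rw [S.d_sq ht]
  unfold lyap
  have p1 := sq_int_nonneg (fun x => S.uxx x t)
  have p2 := sq_int_nonneg (fun x => S.ut x t)
  have p3 := sq_int_nonneg (fun x => S.u x t)
  have p4 := sq_int_nonneg (fun x => S.ux x t)
  generalize (∫ x in (0:ℝ)..π, S.uxx x t * S.uxx x t) = I3 at *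
  generalize (∫ x in (0:ℝ)..π, S.ut x t * S.ut x t) = I1 at *
  generalize (∫ x in (0:ℝ)..π, S.u x t * S.u x t) = U at *
  generalize (∫ x in (0:ℝ)..π, S.ux x t * S.ux x t) = X at *
  generalize (∫ x in (0:ℝ)..π, S.ut x t * S.uxx x t) = I2 at *
  generalize (∫ x in (0:ℝ)..π, S.u x t * S.ut x t) = Y at *
  generalize (∫ x in (0:ℝ)..π, Φ (S.u x t)) = P at *
  have heM0 : 0 ≤ eM := hε.trans heM
  have p5 : 0 ≤ ε t^2 * I3 := by positivity
  generalize ε t^2 * I3 = J at *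
  have h1 : (γ+1) * (-P) ≤ (γ+1) * (M * U) := by gcongr
  have h2 : γ * C t * X ≤ γ * CM * X := by gcongr
  have h3 : (C t - ε' t + ε t * a') * X ≤ (CM + E2 + eM * a') * X := by
    apply mul_le_mul_of_nonneg_right _ p4
    have : ε t * a' ≤ eM * a' := by gcongr
    linarith
  have h4 : θ * Y ≤ θ * ((U + I1)/2) := by
    apply mul_le_mul_of_nonneg_left _ hθ
    linarith
  have h5 : θ * (ε t * X) ≤ θ * (eM * X) := by gcongr
  have hJ : -2 * ε t * I2 ≤ J + I1 := by linarith
  set Q := γ + γ * CM + (γ+1) * M + 2 + CM + E2 + eM * a' + θ + θ * eM + θ * a' with hQ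
  have w1 : 0 ≤ γ * CM := by positivity
  have w2 : 0 ≤ (γ+1) * M := by positivity
  have w3 : 0 ≤ eM * a' := by positivity
  have w4 : 0 ≤ θ * eM := by positivity
  have w5 : 0 ≤ θ * a' := by positivity
  have r1 : 1 * J ≤ Q * J := mul_le_mul_of_nonneg_right (by linarith) p5
  have r2 : (γ * CM/2 + (CM + E2 + eM*a')/2 + θ*eM/2) * X ≤ Q * X := mul_le_mul_of_nonneg_right (by linarith) p4
  have r3 : ((γ+1)*M + θ/2 + θ * a'/2) * U ≤ Q * U := mul_le_mul_of_nonneg_right (by linarith) p3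
  have r4 : (γ/2 + 1 + θ/2) * I1 ≤ Q * I1 := mul_le_mul_of_nonneg_right (by linarith) p2
  clear_value Q
  nlinarith
end ClassicalSolution

lemma sign_lemma {G g : ℝ → ℝ} {ρ : ℝ} (hG : ∀ z, HasDerivAt G (g z) z) (hG0 : G 0 = 0)
    (hg : ∀ z, |z| < ρ → 0 ≤ g z * z) : ∀ z, |z| < ρ → 0 ≤ G z := by
  intro z hz
  have hc : Continuous G := continuous_iff_continuousAt.2 fun z => (hG z).continuousAt
  rcases lt_trichotomy z 0 with h | h | h
  · obtain ⟨c, hc1, hc2⟩ := exists_hasDerivAt_eq_slope G g h hc.continuousOn (fun x _ => hG x)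
    have hcz : |c| < ρ := by
      rw [abs_of_neg h] at hz; rw [abs_of_neg hc1.2]; linarith [hc1.1]
    have h1 := hg c hcz
    have h2 : g c ≤ 0 := by
      by_contra hcon
      push Not at hcon
      nlinarith [mul_pos_of_neg_of_neg (show -g c < 0 by linarith) hc1.2]
    rw [hG0, eq_div_iff (by linarith)] at hc2
    nlinarith
  · rw [h, hG0]
  · obtain ⟨c, hc1, hc2⟩ := exists_hasDerivAt_eq_slope G g h hc.continuousOn (fun x _ => hG x)
    have hcz : |c| < ρ := by
      rw [abs_of_pos h] at hz; rw [abs_of_pos hc1.1]; linarith [hc1.2]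
    have h1 := hg c hcz
    have h2 : 0 ≤ g c := nonneg_of_mul_nonneg_left h1 hc1.1
    rw [hG0, eq_div_iff (by linarith)] at hc2
    nlinarith

lemma zF_le {F F' : ℝ → ℝ} {ρ k : ℝ} (hF : ∀ z, HasDerivAt F (F' z) z) (hF0 : F 0 = 0)
    (hFk : ∀ z, |z| < ρ → F' z ≤ k) : ∀ z, |z| < ρ → z * F z ≤ k * (z * z) := by
  intro z hz
  have hc : Continuous F := continuous_iff_continuousAt.2 fun z => (hF z).continuousAt
  rcases lt_trichotomy z 0 with h | h | h
  · obtain ⟨c, hc1, hc2⟩ := exists_hasDerivAt_eq_slope F F' h hc.continuousOn (fun x _ => hF x)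
    have hcz : |c| < ρ := by
      rw [abs_of_neg h] at hz; rw [abs_of_neg hc1.2]; linarith [hc1.1]
    have h1 := hFk c hcz
    rw [hF0, eq_div_iff (by linarith)] at hc2
    have : F z = F' c * z := by linarith
    rw [this]
    nlinarith [mul_le_mul_of_nonneg_right h1 (mul_self_nonneg z)]
  · simp [h]
  · obtain ⟨c, hc1, hc2⟩ := exists_hasDerivAt_eq_slope F F' h hc.continuousOn (fun x _ => hF x)
    have hcz : |c| < ρ := by
      rw [abs_of_pos h] at hz; rw [abs_of_pos hc1.1]; linarith [hc1.2]
    have h1 := hFk c hcz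
    rw [hF0, eq_div_iff (by linarith)] at hc2
    have : F z = F' c * z := by linarith
    rw [this]
    nlinarith [mul_le_mul_of_nonneg_right h1 (mul_self_nonneg z)]

/-- Upper bound for a primitive. -/
lemma Phi_le {Φ F F' : ℝ → ℝ} {ρ k : ℝ} (hΦ : ∀ z, HasDerivAt Φ (F z) z) (hΦ0 : Φ 0 = 0)
    (hF : ∀ z, HasDerivAt F (F' z) z) (hF0 : F 0 = 0)
    (hFk : ∀ z, |z| < ρ → F' z ≤ k) : ∀ z, |z| < ρ → Φ z ≤ k/2 * (z * z) := by
  have h := sign_lemma (G := fun z => k/2 * (z*z) - Φ z) (g := fun z => k * z - F z) (ρ := ρ)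
    (fun z => by
      have := (((hasDerivAt_id z).mul (hasDerivAt_id z)).const_mul (k/2)).sub (hΦ z)
      refine this.congr_deriv ?_
      simp; ring) (by simp [hΦ0])
    (fun z hz => by
      have := zF_le hF hF0 hFk z hz
      nlinarith)
  intro z hz
  have := h z hz
  linarith

lemma eps_bound {ε ε' : ℝ → ℝ} {μ B : ℝ} (hμ : 0 < μ)
    (hεderiv : ∀ t ∈ Ici (0:ℝ), HasDerivWithinAt ε (ε' t) (Ici 0) t)
    (h : ∀ t ∈ Ioi (0:ℝ), ε' t ≤ 2 * μ * (B - ε t)) :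
    ∀ t ∈ Ici (0:ℝ), ε t ≤ |B| + |ε 0 - B| := by
  have hanti : AntitoneOn (fun t => (ε t - B) * exp (2 * μ * t)) (Ici 0) := by
    have hd : ∀ t ∈ Ioi (0:ℝ), HasDerivAt (fun t => (ε t - B) * exp (2 * μ * t))
        (ε' t * exp (2 * μ * t) + (ε t - B) * (exp (2 * μ * t) * (2 * μ))) t := by
      intro t ht
      have h1 := (hεderiv t (mem_Ici.2 (le_of_lt ht))).hasDerivAt (Ici_mem_nhds ht)
      have h2 : HasDerivAt (fun t : ℝ => 2 * μ * t) (2 * μ) t := by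
        simpa using (hasDerivAt_id t).const_mul (2 * μ)
      exact (h1.sub_const B).mul h2.exp
    apply antitoneOn_of_deriv_nonpos (convex_Ici 0)
    · have hc : ContinuousOn ε (Ici 0) := fun t ht => (hεderiv t ht).continuousWithinAt
      fun_prop
    · intro t ht
      rw [interior_Ici] at ht
      exact (hd t ht).differentiableAt.differentiableWithinAt
    · intro t ht
      rw [interior_Ici] at ht
      rw [(hd t ht).deriv]
      have := h t ht
      have e := exp_pos (2 * μ * t)
      have : (ε' t + 2 * μ * (ε t - B)) * exp (2 * μ * t) ≤ 0 :=
        mul_nonpos_of_nonpos_of_nonneg (by linarith) e.le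
      linarith
  intro t ht
  have h1 := hanti (mem_Ici.2 le_rfl) ht ht
  simp only [mul_zero, exp_zero, mul_one] at h1
  have h2 : 1 ≤ exp (2 * μ * t) := one_le_exp (by have := mem_Ici.1 ht; positivity)
  by_cases hb : ε t ≤ B
  · linarith [le_abs_self B, abs_nonneg (ε 0 - B)]
  · push Not at hb
    have : ε t - B ≤ (ε t - B) * exp (2 * μ * t) := le_mul_of_one_le_right (by linarith) h2
    linarith [le_abs_self B, le_abs_self (ε 0 - B)]

lemma C'_bound {C' : ℝ → ℝ} {γ : ℝ} (hγ : 0 ≤ γ)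
    (hC' : (∀ t ∈ Ici (0:ℝ), C' t ≤ 0) ∨ Tendsto C' atTop (nhds 0)) :
    ∃ κ, 1 ≤ κ ∧ ∀ t, κ ≤ t → (γ+1) * C' t ≤ 1 := by
  rcases hC' with h | h
  · refine ⟨1, le_rfl, fun t ht => ?_⟩
    have := h t (mem_Ici.2 (by linarith))
    nlinarith
  · have h1 := h.const_mul (γ+1)
    rw [mul_zero] at h1
    have h2 := h1.eventually (eventually_le_nhds (show (0:ℝ) < 1 by norm_num))
    obtain ⟨κ, hκ⟩ := eventually_atTop.1 h2
    exact ⟨max 1 κ, le_max_left _ _, fun t ht => hκ t ((le_max_right _ _).trans ht)⟩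
set_option maxHeartbeats 2000000

/-- Theorem 3.1 (uniform stability): if moreover `sup_(t>0) g(t) < ∞`, where
`g(t) = C(t) - ε'(t)/2 + 1`, then the null solution is uniformly stable. -/
theorem null_solution_uniformly_stable
    (ε ε' ε'' C C' F F' : ℝ → ℝ) (a' A τ k ρ μ Cbar εbar ebar : ℝ)
    (hεderiv : ∀ t ∈ Ici (0:ℝ), HasDerivWithinAt ε (ε' t) (Ici 0) t)
    (hε'deriv : ∀ t ∈ Ici (0:ℝ), HasDerivWithinAt ε' (ε'' t) (Ici 0) t)
    (hε''cont : ContinuousOn ε'' (Ici 0))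
    (hεnonneg : ∀ t ∈ Ici (0:ℝ), 0 ≤ ε t)
    (hCderiv : ∀ t ∈ Ici (0:ℝ), HasDerivWithinAt C (C' t) (Ici 0) t)
    (hC'cont : ContinuousOn C' (Ici 0))
    (hFderiv : ∀ z, HasDerivAt F (F' z) z)
    (hF'cont : Continuous F')
    (hF0 : F 0 = 0)
    (hCbar : IsGLB (C '' Ioi (0:ℝ)) Cbar) (hCbarpos : 0 < Cbar)
    (hεbar : IsGLB (ε '' Ioi (0:ℝ)) εbar)
    (hebar : IsGLB (ε'' '' Ioi (0:ℝ)) ebar)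
    (hA : 0 ≤ A) (hτ : 0 ≤ τ) (hk : 0 ≤ k) (hρ : 0 < ρ) (hμ : 0 < μ)
    (hFk : ∀ z, |z| < ρ → F' z ≤ k)
    (hCk : k ≤ Cbar)
    (hdiss : ∀ t ∈ Ici (0:ℝ), μ * (1 + ε t) ≤ C t - ε' t)
    (hmuk : 0 < μ + Cbar / 2 - 2 * k)
    (ha' : 0 ≤ a')
    (ha'ε : 0 < a' + εbar / 2)
    (hC' : (∀ t ∈ Ici (0:ℝ), C' t ≤ 0) ∨ Tendsto C' atTop (nhds 0))
    (hg : ∃ gM, ∀ t ∈ Ioi (0:ℝ), C t - ε' t / 2 + 1 ≤ gM)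
    :
    ∃ ξ, 0 < ξ ∧ ξ ≤ ρ ∧ ∃ κ, 0 ≤ κ ∧
      ∀ σ, 0 < σ → σ ≤ ξ →
        ∃ δ, 0 < δ ∧
          ∀ t₀, κ ≤ t₀ →
            ∀ S : ClassicalSolution ε C F a' t₀,
              (∀ x ∈ Icc (0:ℝ) π, ∀ t ∈ Ici t₀, S.aa x t ≤ A * S.d t ^ τ) →
              S.d t₀ < δ → ∀ t, t₀ ≤ t → S.d t < σ := by
  obtain ⟨gM, hgM⟩ := hg
  have hCge : ∀ t, 0 < t → Cbar ≤ C t := fun t ht => hCbar.1 ⟨t, ht, rfl⟩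
  have hεge : ∀ t, 0 < t → εbar ≤ ε t := fun t ht => hεbar.1 ⟨t, ht, rfl⟩
  have hege : ∀ t, 0 < t → ebar ≤ ε'' t := fun t ht => hebar.1 ⟨t, ht, rfl⟩
  have hεbar0 : 0 ≤ εbar := hεbar.2 (by
    rintro _ ⟨t, ht, rfl⟩
    exact hεnonneg t (mem_Ici.2 (le_of_lt ht)))
  have hb1 : ∀ t, 0 < t → ε' t ≤ 2 * (gM - 1 - μ * (1 + ε t)) := by
    intro t ht
    have h1 := hdiss t (mem_Ici.2 ht.le)
    have h2 := hgM t ht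
    linarith
  have heb := eps_bound (B := (gM - 1 - μ)/μ) hμ hεderiv (by
    intro t ht
    have h1 := hb1 t ht
    have : 2 * μ * ((gM - 1 - μ)/μ - ε t) = 2 * (gM - 1 - μ * (1 + ε t)) := by field_simp; ring
    linarith)
  obtain ⟨eM, heM⟩ : ∃ eM, ∀ t ∈ Ici (0:ℝ), ε t ≤ eM := ⟨_, heb⟩
  have heM0 : 0 ≤ eM := (hεnonneg 0 (by simp)).trans (heM 0 (by simp))
  have hb2 : ∀ t, 0 < t → ε' t ≤ 2 * |gM| := by
    intro t ht
    have h1 := hb1 t ht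
    have : 0 ≤ μ * (1 + ε t) := by
      have := hεnonneg t (mem_Ici.2 ht.le)
      positivity
    linarith [le_abs_self gM]
  have hb3 : ∀ t, 0 < t → - ε' t ≤ 2 * |gM| := by
    intro t ht
    have h1 := hgM t ht
    have h2 := hCge t ht
    linarith [le_abs_self gM]
  have hb4 : ∀ t, 0 < t → C t ≤ 2 * |gM| := by
    intro t ht
    have h1 := hgM t ht
    have h2 := hb2 t ht
    linarith [le_abs_self gM]
  have hgM0 := abs_nonneg gM
  set K : ℝ := (|ebar| + 2 * |gM| * a') / 2 + eM * k with hKdef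
  have hK0 : 0 ≤ K := by positivity
  set c₀ : ℝ := (Cbar + μ) / 2 - k with hc₀
  have hc₀pos : 0 < c₀ := by linarith
  set θ : ℝ := (K + 2) / c₀ with hθdef
  have hθ0 : 0 ≤ θ := by positivity
  have hθK : K + 2 ≤ θ * c₀ := by rw [hθdef, div_mul_cancel₀ _ hc₀pos.ne']
  set m : ℝ := a' + εbar / 2 with hm
  set γ : ℝ := 1 + ((A+1)/(4*μ) + θ^2*(A+1)/4) + (4*θ^2/Cbar + 2) + θ / m with hγdef
  have g1 : 0 ≤ (A+1)/(4*μ) + θ^2*(A+1)/4 := by positivity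
  have g2 : 0 ≤ 4*θ^2/Cbar + 2 := by positivity
  have g3 : 0 ≤ θ / m := by positivity
  have hγ1 : 1 ≤ γ := by linarith
  have hγm : θ ≤ γ * m := by
    have h : θ / m ≤ γ := by linarith
    rwa [div_le_iff₀ ha'ε] at h
  obtain ⟨κ, hκ1, hκ⟩ := C'_bound (γ := γ) (by linarith) hC'
  have hFc : Continuous F := continuous_iff_continuousAt.2 fun z => (hFderiv z).continuousAt
  obtain ⟨Φ, hΦ, hΦ0⟩ : ∃ Φ : ℝ → ℝ, (∀ z, HasDerivAt Φ (F z) z) ∧ Φ 0 = 0 :=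
    ⟨fun z => ∫ y in (0:ℝ)..z, F y, fun z => hFc.integral_hasStrictDerivAt 0 z |>.hasDerivAt, by simp⟩
  have hΦc : Continuous Φ := continuous_iff_continuousAt.2 fun z => (hΦ z).continuousAt
  have hΦk := Phi_le hΦ hΦ0 hFderiv hF0 hFk
  obtain ⟨M, hM⟩ : ∃ M, ∀ z ∈ Icc (-ρ) ρ, ‖F' z‖ ≤ M :=
    isCompact_Icc.exists_bound_of_continuousOn hF'cont.continuousOn
  have hM0 : 0 ≤ M := (norm_nonneg _).trans (hM 0 ⟨by linarith, hρ.le⟩)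
  have hΦM : ∀ z, |z| < ρ → - Φ z ≤ M/2 * (z * z) :=
    Phi_le (Φ := fun z => - Φ z) (F := fun z => - F z) (F' := fun z => - F' z)
      (fun z => (hΦ z).neg) (by simp [hΦ0]) (fun z => (hFderiv z).neg) (by simp [hF0])
      (fun z hz => by
        have := hM z ⟨(abs_lt.1 hz).1.le, (abs_lt.1 hz).2.le⟩
        exact (neg_le_abs _).trans this)
  have hzF := zF_le hFderiv hF0 hFk
  have hεc : ContinuousOn ε (Ici 0) := fun t ht => (hεderiv t ht).continuousWithinAt
  have hε'c : ContinuousOn ε' (Ici 0) := fun t ht => (hε'deriv t ht).continuousWithinAt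
  have hCc : ContinuousOn C (Ici 0) := fun t ht => (hCderiv t ht).continuousWithinAt
  set c₁ : ℝ := min (1/4) (Cbar/16) with hc₁
  have hc₁pos : 0 < c₁ := lt_min (by norm_num) (by positivity)
  have hc₁le : c₁ ≤ 1/4 := min_le_left _ _
  set c₂ : ℝ := γ + γ * (2*|gM|) + (γ+1) * (M/2) + 2 + 2*|gM| + 2*|gM| + eM * a' + θ + θ * eM + θ * a'
    with hc₂
  have hc₂ge : 2 ≤ c₂ := by
    have : 0 ≤ γ * (2*|gM|) := by positivity
    have : 0 ≤ (γ+1) * (M/2) := by positivity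
    have : 0 ≤ eM * a' := by positivity
    have : 0 ≤ θ * eM := by positivity
    have : 0 ≤ θ * a' := by positivity
    linarith
  clear_value c₂ c₁ γ m θ c₀ K
  have hr1 : c₁ / c₂ ≤ 1 := by rw [div_le_one (by linarith)]; linarith
  have hr0 : 0 < c₁ / c₂ := by positivity
  refine ⟨min ρ 1 / 2, by positivity, by linarith [min_le_left ρ 1], κ, by linarith,
    fun σ hσ hσξ => ⟨σ * (c₁ / c₂), by positivity, ?_⟩⟩
  intro t₀ ht₀ S hSa hd0 t₁ ht₁
  have hσρ : σ < ρ := by linarith [min_le_left ρ 1]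
  have hσ1 : σ ≤ 1 := by linarith [min_le_right ρ 1]
  have ht₀1 : 1 ≤ t₀ := hκ1.trans ht₀
  have ht₀0 : 0 ≤ t₀ := by linarith
  have hd0σ : S.d t₀ < σ := hd0.trans_le (mul_le_of_le_one_right hσ.le hr1)
  by_contra hcon
  push Not at hcon
  have hdc := S.d_cont ht₀0 hεc
  have hdc1 : ContinuousOn S.d (Icc t₀ t₁) := hdc.mono Icc_subset_Ici_self
  have hcomp : IsCompact (Icc t₀ t₁ ∩ S.d ⁻¹' Ici σ) :=
    isCompact_Icc.of_isClosed_subset (hdc1.preimage_isClosed_of_isClosed isClosed_Icc isClosed_Ici)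
      inter_subset_left
  obtain ⟨s, hs, hsmin⟩ := hcomp.exists_isLeast ⟨t₁, ⟨ht₁, le_rfl⟩, hcon⟩
  have hsσ : S.d s = σ := by
    have hiv := intermediate_value_Icc hs.1.1 (hdc.mono (Icc_subset_Ici_self : Icc t₀ s ⊆ Ici t₀))
    obtain ⟨r, hr, hrσ⟩ := hiv ⟨hd0σ.le, hs.2⟩
    have : s ≤ r := hsmin ⟨⟨hr.1, hr.2.trans hs.1.2⟩, mem_Ici.2 hrσ.ge⟩
    have : r = s := le_antisymm hr.2 this
    rw [← this]; exact hrσ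
  have hle : ∀ r ∈ Icc t₀ s, S.d r ≤ σ := by
    intro r hr
    by_contra hc
    push Not at hc
    have h1 : s ≤ r := hsmin ⟨⟨hr.1, hr.2.trans hs.1.2⟩, mem_Ici.2 hc.le⟩
    have : r = s := le_antisymm hr.2 h1
    rw [this, hsσ] at hc
    exact lt_irrefl _ hc
  have hderiv : ∀ r ∈ Ioo t₀ s, ∃ D, HasDerivAt (S.lyap ε' Φ γ θ) D r ∧ D ≤ 0 := by
    intro r hr
    have hr0 : 0 < r := by linarith [hr.1]
    have hr0' : r ∈ Ici (0:ℝ) := hr0.le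
    have hrI : r ∈ Ici t₀ := hr.1.le
    have hdr := hle r (Ioo_subset_Icc_self hr)
    have hdρ : S.d r < ρ := hdr.trans_lt hσρ
    refine ⟨_, S.lyap_deriv γ θ hr.1 ((hεderiv r hr0').hasDerivAt (Ici_mem_nhds hr0))
      ((hε'deriv r hr0').hasDerivAt (Ici_mem_nhds hr0))
      ((hCderiv r hr0').hasDerivAt (Ici_mem_nhds hr0)) hFc hΦ, ?_⟩
    have hεr := hεnonneg r hr0'
    have haA : ∀ x ∈ Icc (0:ℝ) π, S.aa x r ≤ A := by
      intro x hx
      refine (hSa x hx r hrI).trans ?_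
      have : S.d r ^ τ ≤ 1 := Real.rpow_le_one (S.d_nonneg r) (hdr.trans hσ1) hτ
      exact mul_le_of_le_one_right hA this
    have hut := S.ut_uxxt hr.1
    refine scalar_D (k := k) (μ := μ) (K := K) (c₀ := c₀) (m := m)
      (ClassicalSolution.sq_int_nonneg (fun x => S.ux x r))
      (ClassicalSolution.sq_int_nonneg (fun x => S.ut x r))
      (ClassicalSolution.sq_int_nonneg (fun x => S.uxx x r))
      (S.u_le_ux hrI) (by linarith) (S.G_int hrI hFderiv hF'cont hF0 hdρ hFk)
      (S.H_int hrI hFc hdρ hzF) hk hεr hμ ha' (S.a_int hrI haA hμ (by linarith))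
      (hdiss r hr0') (by linarith) hθ0 (hκ r (by linarith [hr.1])) ?_ ?_ hθK ?_ hγm
    · have h1 := hege r hr0
      have h2 : ε' r * a' ≤ 2 * |gM| * a' := mul_le_mul_of_nonneg_right (hb2 r hr0) ha'
      have h3 : ε r * k ≤ eM * k := mul_le_mul_of_nonneg_right (heM r hr0') hk
      linarith [neg_le_abs ebar]
    · have h1 := hdiss r hr0'
      have h2 := hCge r hr0
      have h3 := mul_nonneg hμ.le hεr
      rw [mul_add, mul_one] at h1
      linarith
    · linarith [hεge r hr0]
  have hanti : AntitoneOn (S.lyap ε' Φ γ θ) (Icc t₀ s) := by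
    apply antitoneOn_of_deriv_nonpos (convex_Icc _ _)
    · exact (S.lyap_cont ht₀0 γ θ hεc hε'c hCc hΦc).mono Icc_subset_Ici_self
    · intro r hr
      rw [interior_Icc] at hr
      obtain ⟨D, hD, _⟩ := hderiv r hr
      exact hD.differentiableAt.differentiableWithinAt
    · intro r hr
      rw [interior_Icc] at hr
      obtain ⟨D, hD, hD0⟩ := hderiv r hr
      rw [hD.deriv]; exact hD0
  have hV := hanti (left_mem_Icc.2 hs.1.1) (right_mem_Icc.2 hs.1.1) hs.1.1
  have hspos : 0 < s := by linarith [hs.1.1]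
  have hlow := S.lyap_lower (ε' := ε') (γ := γ) (θ := θ) (k := k) (ρ := ρ) (μ := μ) (c := Cbar)
    (mem_Ici.2 hs.1.1) hΦc (hsσ.trans_lt hσρ) hΦk hk (hεnonneg s hspos.le) ha' hθ0 hγ1 hCbarpos
    (hCge s hspos) hCk (by
      have := hdiss s hspos.le
      have h3 := mul_nonneg hμ.le (hεnonneg s hspos.le)
      rw [mul_add, mul_one] at this
      linarith) hmuk (by linarith)
  have ht₀p : 0 < t₀ := by linarith
  have hup := S.lyap_upper (ε' := ε') (γ := γ) (θ := θ) (ρ := ρ) (M := M/2) (CM := 2*|gM|)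
    (E2 := 2*|gM|) (eM := eM) (mem_Ici.2 le_rfl) hΦc (hd0σ.trans hσρ) hΦM (by positivity)
    (hεnonneg t₀ ht₀0) ha' hθ0 (by linarith) (hb4 t₀ ht₀p) (by positivity) (hb3 t₀ ht₀p)
    (by positivity) (heM t₀ ht₀0)
  rw [hsσ, ← hc₁] at hlow
  rw [← hc₂] at hup
  have hsq : S.d t₀ ^2 < (σ * (c₁/c₂))^2 := by
    have := S.d_nonneg t₀
    gcongr
  have h1 : c₂ * S.d t₀ ^2 < c₂ * (σ * (c₁/c₂))^2 := by
    apply mul_lt_mul_of_pos_left hsq (by linarith)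
  have h2 : c₂ * (σ * (c₁/c₂))^2 = (c₁ * σ^2) * (c₁/c₂) := by
    have : c₂ ≠ 0 := by linarith
    field_simp
  have h3 : (c₁ * σ^2) * (c₁/c₂) ≤ c₁ * σ^2 := mul_le_of_le_one_right (by positivity) hr1
  linarith
end
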